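/- arXiv:1505.00156 — 2 statements merged into one kernel-verified Lean document; each statement's English description precedes it below -/
import Mathlib

section
/- Let Ω⊆ℝⁿ be an open bounded set, X = L²(Ω) (real), T>0, and {S(t)}_{t≥0} a compact C0 semigroup on X. Let λ∈ℝ and N_λ := {x∈X : e^{λT}S(T)x = x} be a nonzero (finite-dimensional) subspace such that e^{λt}S(t)x = x and e^{λt}S(t)*x = x for every x∈N_λ and t≥0, where S(t)* is the Hilbert-space adjoint of S(t). Let f:[0,∞)×Ω×ℝ→ℝ be continuous satisfying conditions (a), (b), (d), let F be the associated Nemytskii operator, and assume the Landesman–Lazer condition (LL≠): for every u∈N_λ with ‖u‖=1, ∫₀ᵀ∫_{{u>0}} f₊(t,x)u(x) dx dt + ∫₀ᵀ∫_{{u<0}} f₋(t,x)u(x) dx dt ≠ 0. Then there exists R₁>0 such that for every ε∈(0,1], every continuous u:[0,T]→X with u(T)=u(0) and u(t) = e^{λt}S(t)u(0) + ε∫₀ᵗ e^{λ(t−s)}S(t−s)F(s,u(s)) ds for all t∈[0,T] satisfies ‖u(0)‖ < R₁. -/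
open MeasureTheory Set Filter Topology Bornology intervalIntegral

/-- A strongly continuous family of operators is uniformly bounded on compact sets. -/
theorem exists_opNorm_bound_of_strongly_continuousOn {E : Type*} [NormedAddCommGroup E]
    [NormedSpace ℝ E] [CompleteSpace E] {S : ℝ → E →L[ℝ] E} {K : Set ℝ} (hK : IsCompact K)
    (hS : ∀ x, ContinuousOn (fun t => S t x) K) :
    ∃ M : ℝ, 0 ≤ M ∧ ∀ t ∈ K, ‖S t‖ ≤ M := by
  obtain ⟨M, hM⟩ := banach_steinhaus (g := fun t : K => S t) fun x => by
    obtain ⟨C, hC⟩ := hK.exists_bound_of_continuousOn (hS x)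
    exact ⟨C, fun t => hC t t.2⟩
  exact ⟨max M 0, le_max_right _ _, fun t ht => (hM ⟨t, ht⟩).trans (le_max_left _ _)⟩

/-- A strongly continuous, bounded family of operators applied along continuous data is
continuous. -/
theorem continuousOn_clm_apply_of_strongly_continuousOn {E : Type*} [NormedAddCommGroup E]
    [NormedSpace ℝ E] {A : ℝ → E →L[ℝ] E} {K : Set ℝ} {M : ℝ}
    (hA : ∀ x, ContinuousOn (fun t => A t x) K)
    (hM : ∀ t ∈ K, ‖A t‖ ≤ M) {v : ℝ → E} (hv : ContinuousOn v K) :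
    ContinuousOn (fun t => A t (v t)) K := by
  intro t ht
  have h1 : Tendsto (fun s => A s (v s - v t)) (𝓝[K] t) (𝓝 0) := by
    have h2 : Tendsto (fun s => M * ‖v s - v t‖) (𝓝[K] t) (𝓝 0) := by
      have h3 : Tendsto (fun s => v s - v t) (𝓝[K] t) (𝓝 (v t - v t)) :=
        (hv t ht).sub tendsto_const_nhds
      simpa using h3.norm.const_mul M
    refine squeeze_zero_norm' ?_ h2
    filter_upwards [self_mem_nhdsWithin] with s hs
    exact (A s).le_of_opNorm_le (hM s hs) _
  have h4 : Tendsto (fun s => A s (v s - v t) + A s (v t)) (𝓝[K] t) (𝓝 (0 + A t (v t))) :=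
    h1.add (hA (v t) t ht)
  simpa [ContinuousWithinAt] using h4

section Lp

variable {α : Type*} [MeasurableSpace α] {μ : Measure α}

/-- Bounded convergence in `L²` of a finite measure. -/
theorem tendsto_Lp_two_of_bounded_of_tendsto_ae [IsFiniteMeasure μ] {ι : Type*} {l : Filter ι}
    [l.IsCountablyGenerated] {G : ι → Lp ℝ 2 μ} {G₀ : Lp ℝ 2 μ} {h : ι → α → ℝ} {h₀ : α → ℝ}
    {m : ℝ} (hG : ∀ᶠ i in l, G i =ᵐ[μ] h i) (hG₀ : G₀ =ᵐ[μ] h₀)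
    (hb : ∀ᶠ i in l, ∀ᵐ x ∂μ, |h i x| ≤ m) (hb₀ : ∀ᵐ x ∂μ, |h₀ x| ≤ m)
    (hlim : ∀ᵐ x ∂μ, Tendsto (fun i => h i x) l (𝓝 (h₀ x))) :
    Tendsto G l (𝓝 G₀) := by
  have hsq : Tendsto (fun i => ∫ x, ‖(G i - G₀ : Lp ℝ 2 μ) x‖ ^ 2 ∂μ) l (𝓝 0) := by
    have key : Tendsto (fun i => ∫ x, (h i x - h₀ x) ^ 2 ∂μ) l (𝓝 (∫ _, (0 : ℝ) ∂μ)) := by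
      refine tendsto_integral_filter_of_dominated_convergence (fun _ => (2 * m) ^ 2) ?_ ?_
        (integrable_const _) ?_
      · filter_upwards [hG] with i hi
        exact (((Lp.aestronglyMeasurable (G i)).congr hi).sub
          ((Lp.aestronglyMeasurable G₀).congr hG₀)).pow 2
      · filter_upwards [hb] with i hi
        filter_upwards [hi, hb₀] with x h1 h2
        rw [Real.norm_eq_abs, abs_pow]
        gcongr
        linarith [abs_sub (h i x) (h₀ x)]
      · filter_upwards [hlim] with x hx
        have h3 := (hx.sub (tendsto_const_nhds (x := h₀ x))).pow 2
        simpa using h3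
    rw [integral_zero] at key
    refine key.congr' ?_
    filter_upwards [hG] with i hi
    refine integral_congr_ae ?_
    filter_upwards [hi, hG₀, Lp.coeFn_sub (G i) G₀] with x h1 h2 h3
    rw [h3, Pi.sub_apply, h1, h2, Real.norm_eq_abs, sq_abs]
  have hnorm : ∀ g : Lp ℝ 2 μ, ∫ x, ‖g x‖ ^ 2 ∂μ = ‖g‖ ^ 2 := fun g => by
    rw [← real_inner_self_eq_norm_sq, L2.inner_def]
    simp
  simp only [hnorm] at hsq
  rw [tendsto_iff_norm_sub_tendsto_zero]
  simpa [Real.sqrt_sq] using hsq.sqrt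

/-- The limit behind the Landesman–Lazer condition: along functions `u i` whose rescalings converge
in `L²` to `z`, the pairing of a bounded nonlinearity with `z` only sees its limits at `±∞`. -/
theorem tendsto_inner_nemytskii_of_rescaled_tendsto {φ : α → ℝ → ℝ} {φp φm : α → ℝ}
    [IsFiniteMeasure μ] {m : ℝ}
    (hφ : ∀ᵐ x ∂μ, ∀ y, |φ x y| ≤ m)
    (hp : ∀ᵐ x ∂μ, Tendsto (φ x) atTop (𝓝 (φp x)))
    (hm : ∀ᵐ x ∂μ, Tendsto (φ x) atBot (𝓝 (φm x)))
    (hpm : AEStronglyMeasurable φp μ) (hmm : AEStronglyMeasurable φm μ)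
    {u G : ℕ → Lp ℝ 2 μ} {z : Lp ℝ 2 μ} {r : ℕ → ℝ} (hr : Tendsto r atTop atTop)
    (hu : Tendsto (fun k => (r k)⁻¹ • u k) atTop (𝓝 z))
    (hG : ∀ k, ∀ᵐ x ∂μ, G k x = φ x (u k x)) :
    Tendsto (fun k => (inner ℝ (G k) z : ℝ)) atTop
      (𝓝 ((∫ x in {x | 0 < z x}, φp x * z x ∂μ) + ∫ x in {x | z x < 0}, φm x * z x ∂μ)) := by
  have hz : Integrable z μ := (Lp.memLp z).integrable (by norm_num)
  have hzp : MeasurableSet {x | 0 < z x} :=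
    measurableSet_lt measurable_const (Lp.stronglyMeasurable z).measurable
  have hzm : MeasurableSet {x | z x < 0} :=
    measurableSet_lt (Lp.stronglyMeasurable z).measurable measurable_const
  have hip : Integrable (fun x => φp x * z x) μ := by
    refine hz.bdd_mul (c := m) hpm ?_
    filter_upwards [hφ, hp] with x h1 h2
    exact le_of_tendsto h2.norm (Eventually.of_forall fun y => h1 y)
  have him : Integrable (fun x => φm x * z x) μ := by
    refine hz.bdd_mul (c := m) hmm ?_
    filter_upwards [hφ, hm] with x h1 h2
    exact le_of_tendsto h2.norm (Eventually.of_forall fun y => h1 y)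
  rw [← MeasureTheory.integral_indicator hzp, ← MeasureTheory.integral_indicator hzm,
    ← integral_add (hip.indicator hzp) (him.indicator hzm)]
  refine tendsto_of_subseq_tendsto fun ns hns => ?_
  obtain ⟨ms, hmono, hms⟩ := (tendstoInMeasure_of_tendsto_Lp (hu.comp hns)).exists_seq_tendsto_ae
  refine ⟨ms, ?_⟩
  have hidx : Tendsto (fun k => ns (ms k)) atTop atTop := hns.comp hmono.tendsto_atTop
  have hrr := hr.comp hidx
  simp only [L2.inner_def]
  refine tendsto_integral_of_dominated_convergence (fun x => m * ‖z x‖) ?_ (hz.norm.const_mul m)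
    ?_ ?_
  · intro k
    exact (Lp.aestronglyMeasurable _).inner (Lp.aestronglyMeasurable _)
  · intro k
    filter_upwards [hG (ns (ms k)), hφ] with x h1 h2
    refine (norm_inner_le_norm _ _).trans ?_
    rw [h1]
    gcongr
    exact h2 _
  · have hall : ∀ᵐ x ∂μ, ∀ k, G k x = φ x (u k x) := ae_all_iff.2 hG
    have hsm : ∀ᵐ x ∂μ, ∀ k, ((r k)⁻¹ • u k : Lp ℝ 2 μ) x = (r k)⁻¹ * u k x :=
      ae_all_iff.2 fun k => by
        filter_upwards [Lp.coeFn_smul (r k)⁻¹ (u k)] with x hx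
        simpa using hx
    filter_upwards [hall, hsm, hms, hp, hm, hφ] with x h1 h2 h3 h4 h5 h6
    have hux : ∀ᶠ k in atTop, u (ns (ms k)) x =
        r (ns (ms k)) * ((r (ns (ms k)))⁻¹ • u (ns (ms k)) : Lp ℝ 2 μ) x := by
      filter_upwards [hrr.eventually_gt_atTop 0] with k hk
      have hk' : r (ns (ms k)) ≠ 0 := ne_of_gt hk
      rw [h2, mul_inv_cancel_left₀ hk']
    have hin : ∀ k, (inner ℝ (G (ns (ms k)) x) (z x) : ℝ) = φ x (u (ns (ms k)) x) * z x := by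
      intro k
      rw [h1]
      simp [mul_comm]
    simp only [hin]
    rcases lt_trichotomy (z x) 0 with hneg | hzero | hpos
    · have hd : Tendsto (fun k => u (ns (ms k)) x) atTop atBot :=
        (hrr.atTop_mul_neg hneg h3).congr' (hux.mono fun k hk => hk.symm)
      simpa [indicator, hneg, hneg.not_gt] using (h5.comp hd).mul_const (z x)
    · simp [indicator, hzero]
    · have hd : Tendsto (fun k => u (ns (ms k)) x) atTop atTop :=
        (hrr.atTop_mul_pos hpos h3).congr' (hux.mono fun k hk => hk.symm)
      simpa [indicator, hpos, hpos.not_gt] using (h4.comp hd).mul_const (z x)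

/-- A Nemytskii operator which is Lipschitz in the state and bounded is continuous along continuous
curves. -/
theorem continuousOn_nemytskii_comp [IsFiniteMeasure μ] {K : Set ℝ} {φ : ℝ → α → ℝ → ℝ} {m L : ℝ}
    (hb : ∀ t ∈ K, ∀ᵐ x ∂μ, ∀ y, |φ t x y| ≤ m)
    (hL : ∀ t ∈ K, ∀ᵐ x ∂μ, ∀ y₁ y₂, |φ t x y₁ - φ t x y₂| ≤ L * |y₁ - y₂|)
    (hc : ∀ᵐ x ∂μ, ∀ y, ContinuousOn (fun t => φ t x y) K)
    {F : ℝ → Lp ℝ 2 μ → Lp ℝ 2 μ} (hF : ∀ t ∈ K, ∀ u : Lp ℝ 2 μ, ∀ᵐ x ∂μ, F t u x = φ t x (u x))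
    {v : ℝ → Lp ℝ 2 μ} (hv : ContinuousOn v K) : ContinuousOn (fun t => F t (v t)) K := by
  intro t ht
  have h1 : Tendsto (fun s => F s (v t)) (𝓝[K] t) (𝓝 (F t (v t))) := by
    refine tendsto_Lp_two_of_bounded_of_tendsto_ae (m := m) (h := fun s x => φ s x (v t x))
      (h₀ := fun x => φ t x (v t x)) ?_ (hF t ht _) ?_ ?_ ?_
    · filter_upwards [self_mem_nhdsWithin] with s hs using hF s hs _
    · filter_upwards [self_mem_nhdsWithin] with s hs
      filter_upwards [hb s hs] with x hx using hx _
    · filter_upwards [hb t ht] with x hx using hx _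
    · filter_upwards [hc] with x hx using hx _ t ht
  have h2 : Tendsto (fun s => F s (v s) - F s (v t)) (𝓝[K] t) (𝓝 0) := by
    have h3 : Tendsto (fun s => L * ‖v s - v t‖) (𝓝[K] t) (𝓝 0) := by
      have h4 : Tendsto (fun s => v s - v t) (𝓝[K] t) (𝓝 (v t - v t)) :=
        (hv t ht).sub tendsto_const_nhds
      simpa using h4.norm.const_mul L
    refine squeeze_zero_norm' ?_ h3
    filter_upwards [self_mem_nhdsWithin] with s hs
    refine Lp.norm_le_mul_norm_of_ae_le_mul ?_
    filter_upwards [hF s hs (v s), hF s hs (v t), Lp.coeFn_sub (F s (v s)) (F s (v t)),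
      Lp.coeFn_sub (v s) (v t), hL s hs] with x h5 h6 h7 h8 h9
    rw [h7, h8, Pi.sub_apply, Pi.sub_apply, h5, h6]
    exact h9 _ _
  have h10 := h2.add h1
  simpa [ContinuousWithinAt] using h10

/-- Pairing a bounded, time-continuous coefficient with an integrable function depends
continuously on time. -/
theorem continuousOn_integral_mul_of_bounded {K : Set ℝ} {a : ℝ → α → ℝ} {m : ℝ} {z : α → ℝ}
    (hz : Integrable z μ) (ham : ∀ t ∈ K, AEStronglyMeasurable (a t) μ)
    (hb : ∀ t ∈ K, ∀ᵐ x ∂μ, |a t x| ≤ m) (hc : ∀ᵐ x ∂μ, ContinuousOn (fun t => a t x) K) :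
    ContinuousOn (fun t => ∫ x, a t x * z x ∂μ) K := by
  intro t ht
  refine continuousWithinAt_of_dominated (bound := fun x => m * ‖z x‖) ?_ ?_ (hz.norm.const_mul m)
    ?_
  · filter_upwards [self_mem_nhdsWithin] with s hs
    exact (ham s hs).mul hz.aestronglyMeasurable
  · filter_upwards [self_mem_nhdsWithin] with s hs
    filter_upwards [hb s hs] with x hx
    rw [norm_mul]
    gcongr
    exact hx
  · filter_upwards [hc] with x hx
    exact (hx t ht).mul continuousWithinAt_const

end Lp

/-- If approximate fixed points of a compact operator lie on the unit sphere, a subsequence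
converges to a fixed point on the unit sphere. -/
theorem exists_unit_fixedPoint_of_compact {E : Type*} [NormedAddCommGroup E]
    [NormedSpace ℝ E] {A : E →L[ℝ] E} (hA : IsCompact (closure (A '' Metric.closedBall 0 1)))
    {x : ℕ → E} (hx : ∀ k, ‖x k‖ = 1) (hlim : Tendsto (fun k => x k - A (x k)) atTop (𝓝 0)) :
    ∃ z : E, ∃ σ : ℕ → ℕ, StrictMono σ ∧ Tendsto (x ∘ σ) atTop (𝓝 z) ∧ A z = z ∧ ‖z‖ = 1 := by
  obtain ⟨z, -, σ, hσ, hz⟩ := hA.tendsto_subseq (x := fun k => A (x k)) fun k =>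
    subset_closure (mem_image_of_mem A (by simp [hx k]))
  have hxz : Tendsto (x ∘ σ) atTop (𝓝 z) := by
    have h := (hlim.comp hσ.tendsto_atTop).add hz
    simpa [Function.comp_def] using h
  refine ⟨z, σ, hσ, hxz, ?_, ?_⟩
  · exact tendsto_nhds_unique ((A.continuous.tendsto z).comp hxz) hz
  · refine tendsto_nhds_unique hxz.norm ?_
    simp [hx]

/-- Solvability condition for the linear periodic problem: the forcing of a periodic mild solution
is orthogonal on average to the vectors fixed by the adjoint semigroup. -/
theorem integral_inner_eq_zero_of_periodic_mild {E : Type*} [NormedAddCommGroup E]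
    [InnerProductSpace ℝ E] [CompleteSpace E] {A : ℝ → E →L[ℝ] E} {T ε : ℝ} (hT : 0 ≤ T)
    (hε : ε ≠ 0) {g : ℝ → E} {x z : E}
    (hg : ContinuousOn (fun s => A (T - s) (g s)) (Icc 0 T))
    (hz : ∀ t ∈ Icc 0 T, ContinuousLinearMap.adjoint (A t) z = z)
    (hx : x = A T x + ε • ∫ s in (0 : ℝ)..T, A (T - s) (g s)) :
    ∫ s in (0 : ℝ)..T, inner ℝ (g s) z = 0 := by
  have hint : IntervalIntegrable (fun s => A (T - s) (g s)) volume 0 T :=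
    hg.intervalIntegrable_of_Icc hT
  have hAz : ∀ t ∈ Icc 0 T, ∀ y, inner ℝ (A t y) z = inner ℝ y z := fun t ht y => by
    rw [← ContinuousLinearMap.adjoint_inner_right, hz t ht]
  have h1 := congrArg (fun y : E => (inner ℝ y z : ℝ)) hx
  simp only [inner_add_left, hAz T ⟨hT, le_rfl⟩, real_inner_smul_left] at h1
  have h2 : inner ℝ (∫ s in (0 : ℝ)..T, A (T - s) (g s)) z = 0 := by
    have h3 : ε * inner ℝ (∫ s in (0 : ℝ)..T, A (T - s) (g s)) z = 0 := by linarith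
    exact (mul_eq_zero.1 h3).resolve_left hε
  have h4 := (innerSL ℝ z : E →L[ℝ] ℝ).intervalIntegral_comp_comm hint
  simp only [innerSL_apply_apply] at h4
  rw [real_inner_comm, ← h4] at h2
  refine (intervalIntegral.integral_congr fun s hs => ?_).trans h2
  rw [uIcc_of_le hT] at hs
  have h5 : T - s ∈ Icc 0 T := ⟨by linarith [hs.2], by linarith [hs.1]⟩
  rw [← hAz _ h5, real_inner_comm]

/-- Rescaled mild solutions with bounded forcing follow the linear flow when the scale blows up. -/
theorem tendsto_rescaled_mild {E : Type*} [NormedAddCommGroup E] [NormedSpace ℝ E]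
    {A : E →L[ℝ] E} {C : ℝ} {r : ℕ → ℝ} (hr : Tendsto r atTop atTop) {x y w : ℕ → E} {z : E}
    (hw : ∀ k, ‖w k‖ ≤ C) (hy : ∀ k, y k = A (x k) + w k)
    (hx : Tendsto (fun k => (r k)⁻¹ • x k) atTop (𝓝 z)) :
    Tendsto (fun k => (r k)⁻¹ • y k) atTop (𝓝 (A z)) := by
  have h1 : Tendsto (fun k => (r k)⁻¹ • w k) atTop (𝓝 0) :=
    (tendsto_inv_atTop_zero.comp hr).zero_smul_isBoundedUnder_le
      (isBoundedUnder_of ⟨C, fun k => hw k⟩)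
  have h2 := ((A.continuous.tendsto z).comp hx).add h1
  rw [add_zero] at h2
  refine h2.congr fun k => ?_
  simp [hy k, smul_add]

set_option maxHeartbeats 1000000 in
/-- a priori bounds for the resonant periodic problem
`u' = -Au + λu + εF(t,u)` in `X = L²(Ω)` under the Landesman–Lazer type
condition (LL≠): there is `R₁ > 0` such that for every `ε ∈ (0,1]` every
`T`-periodic mild solution `u` satisfies `‖u(0)‖ < R₁`. -/
theorem statement12
    (n : ℕ) (Ω : Set (EuclideanSpace ℝ (Fin n)))
    (hΩo : IsOpen Ω) (hΩb : Bornology.IsBounded Ω)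
    (T : ℝ) (hT : 0 < T)
    (S : ℝ → Lp ℝ 2 (volume.restrict Ω) →L[ℝ] Lp ℝ 2 (volume.restrict Ω))
    (hS0 : S 0 = 1)
    (hSadd : ∀ t s : ℝ, 0 ≤ t → 0 ≤ s → S (t + s) = (S t).comp (S s))
    (hScont : ∀ x : Lp ℝ 2 (volume.restrict Ω),
      ContinuousOn (fun t => S t x) (Set.Ici (0:ℝ)))
    (hScomp : ∀ t : ℝ, 0 < t → ∀ B : Set (Lp ℝ 2 (volume.restrict Ω)),
      Bornology.IsBounded B → IsCompact (closure (S t '' B)))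
    (lam : ℝ)
    -- `N_λ = {x : e^{λT} S(T) x = x}` is a nonzero subspace, pointwise fixed (with
    -- its elements) by `e^{λt}S(t)` and by `e^{λt}S(t)*` for all `t ≥ 0`
    (hNne : ∃ x : Lp ℝ 2 (volume.restrict Ω),
      Real.exp (lam * T) • S T x = x ∧ x ≠ 0)
    (hfix : ∀ x : Lp ℝ 2 (volume.restrict Ω), Real.exp (lam * T) • S T x = x →
      ∀ t : ℝ, 0 ≤ t → Real.exp (lam * t) • S t x = x)
    (hfixadj : ∀ x : Lp ℝ 2 (volume.restrict Ω), Real.exp (lam * T) • S T x = x →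
      ∀ t : ℝ, 0 ≤ t → Real.exp (lam * t) • (ContinuousLinearMap.adjoint (S t)) x = x)
    (f : ℝ → EuclideanSpace ℝ (Fin n) → ℝ → ℝ)
    (hfc : ContinuousOn (fun p : ℝ × EuclideanSpace ℝ (Fin n) × ℝ =>
      f p.1 p.2.1 p.2.2) (Set.Ici (0:ℝ) ×ˢ Ω ×ˢ Set.univ))
    -- condition (a): boundedness
    (m : ℝ) (hm : 0 < m)
    (hfa : ∀ t : ℝ, 0 ≤ t → ∀ x ∈ Ω, ∀ y : ℝ, |f t x y| ≤ m)
    -- condition (b): uniform Lipschitz continuity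
    (L : ℝ) (hL : 0 < L)
    (hfb : ∀ t : ℝ, 0 ≤ t → ∀ x ∈ Ω, ∀ y₁ y₂ : ℝ,
      |f t x y₁ - f t x y₂| ≤ L * |y₁ - y₂|)
    -- condition (d): limits at ±∞
    (fp fm : ℝ → EuclideanSpace ℝ (Fin n) → ℝ)
    (hfpc : ContinuousOn (fun p : ℝ × EuclideanSpace ℝ (Fin n) => fp p.1 p.2)
      (Set.Ici (0:ℝ) ×ˢ Ω))
    (hfmc : ContinuousOn (fun p : ℝ × EuclideanSpace ℝ (Fin n) => fm p.1 p.2)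
      (Set.Ici (0:ℝ) ×ˢ Ω))
    (hfp : ∀ t : ℝ, 0 ≤ t → ∀ x ∈ Ω,
      Filter.Tendsto (fun y => f t x y) Filter.atTop (nhds (fp t x)))
    (hfm : ∀ t : ℝ, 0 ≤ t → ∀ x ∈ Ω,
      Filter.Tendsto (fun y => f t x y) Filter.atBot (nhds (fm t x)))
    -- `F` is the Nemytskii operator associated with `f`
    (F : ℝ → Lp ℝ 2 (volume.restrict Ω) → Lp ℝ 2 (volume.restrict Ω))
    (hF : ∀ t : ℝ, 0 ≤ t → ∀ u : Lp ℝ 2 (volume.restrict Ω),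
      ∀ᵐ x ∂(volume.restrict Ω), F t u x = f t x (u x))
    -- Landesman–Lazer type condition (LL≠)
    (hLL : ∀ u : Lp ℝ 2 (volume.restrict Ω),
      Real.exp (lam * T) • S T u = u → ‖u‖ = 1 →
      (∫ t in (0:ℝ)..T, ∫ x in {x | 0 < u x}, fp t x * u x ∂(volume.restrict Ω)) +
      (∫ t in (0:ℝ)..T, ∫ x in {x | u x < 0}, fm t x * u x ∂(volume.restrict Ω))
        ≠ 0) :
    ∃ R₁ : ℝ, 0 < R₁ ∧
      ∀ ε : ℝ, 0 < ε → ε ≤ 1 →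
      ∀ u : ℝ → Lp ℝ 2 (volume.restrict Ω),
        ContinuousOn u (Set.Icc (0:ℝ) T) → u T = u 0 →
        (∀ t ∈ Set.Icc (0:ℝ) T,
          u t = Real.exp (lam * t) • S t (u 0) +
            ε • ∫ s in (0:ℝ)..t,
              Real.exp (lam * (t - s)) • S (t - s) (F s (u s))) →
        ‖u 0‖ < R₁ := by
  have : IsFiniteMeasure (volume.restrict Ω) :=
    isFiniteMeasure_restrict.2 hΩb.measure_lt_top.ne
  have hmem : ∀ᵐ x ∂(volume.restrict Ω), x ∈ Ω := ae_restrict_mem hΩo.measurableSet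
  have hfpm : ∀ t, 0 ≤ t → AEStronglyMeasurable (fp t) (volume.restrict Ω) := fun t ht =>
    (hfpc.comp (f := fun x => (t, x)) (by fun_prop) fun x hx => ⟨ht, hx⟩).aestronglyMeasurable
      hΩo.measurableSet
  have hfmm : ∀ t, 0 ≤ t → AEStronglyMeasurable (fm t) (volume.restrict Ω) := fun t ht =>
    (hfmc.comp (f := fun x => (t, x)) (by fun_prop) fun x hx => ⟨ht, hx⟩).aestronglyMeasurable
      hΩo.measurableSet
  have hfpb : ∀ t, 0 ≤ t → ∀ x ∈ Ω, |fp t x| ≤ m := fun t ht x hx =>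
    le_of_tendsto (hfp t ht x hx).abs (Eventually.of_forall (hfa t ht x hx))
  have hfmb : ∀ t, 0 ≤ t → ∀ x ∈ Ω, |fm t x| ≤ m := fun t ht x hx =>
    le_of_tendsto (hfm t ht x hx).abs (Eventually.of_forall (hfa t ht x hx))
  obtain ⟨B, hB0, hB⟩ : ∃ B : ℝ, 0 ≤ B ∧ ∀ t, 0 ≤ t → ∀ v, ‖F t v‖ ≤ B := by
    refine ⟨_, ?_, fun t ht v => Lp.norm_le_of_ae_bound hm.le ?_⟩
    · positivity
    · filter_upwards [hF t ht v, hmem] with x h1 h2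
      rw [h1]
      exact hfa t ht x h2 _
  set A : ℝ → Lp ℝ 2 (volume.restrict Ω) →L[ℝ] Lp ℝ 2 (volume.restrict Ω) :=
    fun t => Real.exp (lam * t) • S t with hA
  have hAapp : ∀ t x, Real.exp (lam * t) • S t x = A t x := fun t x => rfl
  simp only [hAapp] at hfix hLL ⊢
  have hAcont : ∀ x, ContinuousOn (fun t => A t x) (Icc 0 T) := fun x =>
    ContinuousOn.smul (f := fun t => Real.exp (lam * t)) (by fun_prop)
      ((hScont x).mono Icc_subset_Ici_self)
  have hAadj : ∀ z, A T z = z → ∀ t ∈ Icc 0 T, ContinuousLinearMap.adjoint (A t) z = z := by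
    intro z hz t ht
    rw [hA, map_smulₛₗ]
    exact hfixadj z hz t ht.1
  have hAcomp : IsCompact (closure (A T '' Metric.closedBall 0 1)) := by
    have h := (hScomp T hT _ (Metric.isBounded_closedBall (x := 0) (r := 1))).smul
      (Real.exp (lam * T))
    refine h.closure_of_subset ?_
    rintro _ ⟨x, hx, rfl⟩
    exact smul_mem_smul_set (subset_closure (mem_image_of_mem _ hx))
  obtain ⟨M, hM0, hM⟩ := exists_opNorm_bound_of_strongly_continuousOn isCompact_Icc hAcont
  by_contra hcon
  push Not at hcon
  choose ε hε0 hε1 u huc huT hu hlarge using fun k : ℕ => hcon (k + 1) (by positivity)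
  have hrefl : ∀ t ∈ Icc 0 T, MapsTo (fun s => t - s) (Icc 0 t) (Icc 0 T) := fun t ht s hs =>
    ⟨by linarith [hs.2], by linarith [hs.1, ht.2]⟩
  have hFc : ∀ k, ContinuousOn (fun s => F s (u k s)) (Icc 0 T) := fun k =>
    continuousOn_nemytskii_comp (φ := f) (m := m) (L := L)
      (fun t ht => hmem.mono fun x hx => hfa t ht.1 x hx)
      (fun t ht => hmem.mono fun x hx => hfb t ht.1 x hx)
      (hmem.mono fun x hx y => hfc.comp (f := fun t => (t, x, y)) (by fun_prop)
        fun t ht => ⟨ht.1, hx, mem_univ _⟩)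
      (fun t ht => hF t ht.1) (huc k)
  have hforc : ∀ k, ContinuousOn (fun s => A (T - s) (F s (u k s))) (Icc 0 T) := fun k =>
    continuousOn_clm_apply_of_strongly_continuousOn (A := fun s => A (T - s)) (M := M)
      (fun x => (hAcont x).comp (f := fun s => T - s) (by fun_prop) (hrefl T ⟨hT.le, le_rfl⟩))
      (fun s hs => hM _ (hrefl T ⟨hT.le, le_rfl⟩ hs)) (hFc k)
  have hw : ∀ t ∈ Icc 0 T, ∀ k,
      ‖ε k • ∫ s in (0 : ℝ)..t, A (t - s) (F s (u k s))‖ ≤ M * B * T := by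
    intro t ht k
    have h1 : ‖∫ s in (0 : ℝ)..t, A (t - s) (F s (u k s))‖ ≤ M * B * |t - 0| := by
      refine norm_integral_le_of_norm_le_const fun s hs => ?_
      rw [uIoc_of_le ht.1] at hs
      exact (A (t - s)).le_of_opNorm_le_of_le (hM _ (hrefl t ht ⟨hs.1.le, hs.2⟩))
        (hB s hs.1.le _)
    rw [sub_zero, abs_of_nonneg ht.1] at h1
    rw [norm_smul, Real.norm_eq_abs, abs_of_pos (hε0 k)]
    calc ε k * ‖∫ s in (0 : ℝ)..t, A (t - s) (F s (u k s))‖ ≤ 1 * (M * B * T) := by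
          gcongr
          · exact hε1 k
          · exact h1.trans (by gcongr; exact ht.2)
      _ = M * B * T := one_mul _
  have hr : Tendsto (fun k => ‖u k 0‖) atTop atTop :=
    tendsto_atTop_mono hlarge (tendsto_atTop_add_const_right _ _ tendsto_natCast_atTop_atTop)
  have hrpos : ∀ k, 0 < ‖u k 0‖ := fun k => lt_of_lt_of_le (by positivity) (hlarge k)
  have hperiod : ∀ k, u k 0 = A T (u k 0) + ε k • ∫ s in (0 : ℝ)..T, A (T - s) (F s (u k s)) :=
    fun k => (huT k).symm.trans (hu k T ⟨hT.le, le_rfl⟩)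
  obtain ⟨z, σ, hσ, hz, hfixz, hz1⟩ := exists_unit_fixedPoint_of_compact hAcomp
    (x := fun k => ‖u k 0‖⁻¹ • u k 0)
    (fun k => by rw [norm_smul, norm_inv, norm_norm, inv_mul_cancel₀ (hrpos k).ne'])
    (by
      have h1 := (tendsto_inv_atTop_zero.comp hr).zero_smul_isBoundedUnder_le
        (isBoundedUnder_of ⟨M * B * T, hw T ⟨hT.le, le_rfl⟩⟩)
      refine h1.congr fun k => ?_
      rw [map_smul, ← smul_sub, ← eq_sub_iff_add_eq'.2 (hperiod k).symm]
      rfl)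
  have hrσ : Tendsto (fun k => ‖u (σ k) 0‖) atTop atTop := hr.comp hσ.tendsto_atTop
  have hlim : ∀ t ∈ Icc 0 T, Tendsto (fun k => (inner ℝ (F t (u (σ k) t)) z : ℝ)) atTop
      (𝓝 ((∫ x in {x | 0 < z x}, fp t x * z x ∂(volume.restrict Ω)) +
        ∫ x in {x | z x < 0}, fm t x * z x ∂(volume.restrict Ω))) := by
    intro t ht
    have h1 := tendsto_rescaled_mild hrσ (fun k => hw t ht (σ k)) (fun k => hu (σ k) t ht) hz
    rw [hfix z hfixz t ht.1] at h1
    exact tendsto_inner_nemytskii_of_rescaled_tendsto (φ := f t) (m := m)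
      (hmem.mono fun x hx => hfa t ht.1 x hx) (hmem.mono fun x hx => hfp t ht.1 x hx)
      (hmem.mono fun x hx => hfm t ht.1 x hx) (hfpm t ht.1) (hfmm t ht.1) hrσ h1
      (fun k => hF t ht.1 _)
  have hzi : Integrable z (volume.restrict Ω) := (Lp.memLp z).integrable (by norm_num)
  have hpint : IntervalIntegrable
      (fun t => ∫ x in {x | 0 < z x}, fp t x * z x ∂(volume.restrict Ω)) volume 0 T := by
    refine (continuousOn_integral_mul_of_bounded (m := m) hzi.restrict
      (fun t ht => (hfpm t ht.1).restrict)
      (fun t ht => ae_restrict_of_ae (hmem.mono fun x hx => hfpb t ht.1 x hx))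
      (ae_restrict_of_ae (hmem.mono fun x hx => ?_))).intervalIntegrable_of_Icc hT.le
    exact hfpc.comp (f := fun t => (t, x)) (by fun_prop) fun t ht => ⟨ht.1, hx⟩
  have hmint : IntervalIntegrable
      (fun t => ∫ x in {x | z x < 0}, fm t x * z x ∂(volume.restrict Ω)) volume 0 T := by
    refine (continuousOn_integral_mul_of_bounded (m := m) hzi.restrict
      (fun t ht => (hfmm t ht.1).restrict)
      (fun t ht => ae_restrict_of_ae (hmem.mono fun x hx => hfmb t ht.1 x hx))
      (ae_restrict_of_ae (hmem.mono fun x hx => ?_))).intervalIntegrable_of_Icc hT.le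
    exact hfmc.comp (f := fun t => (t, x)) (by fun_prop) fun t ht => ⟨ht.1, hx⟩
  refine hLL z hfixz hz1 ?_
  rw [← intervalIntegral.integral_add hpint hmint]
  have hzero : ∀ k, ∫ s in (0 : ℝ)..T, (inner ℝ (F s (u (σ k) s)) z : ℝ) = 0 := fun k =>
    integral_inner_eq_zero_of_periodic_mild hT.le (hε0 (σ k)).ne' (hforc (σ k)) (hAadj z hfixz)
      (hperiod (σ k))
  have hconv := intervalIntegral.tendsto_integral_filter_of_dominated_convergence (μ := volume)
    (a := 0) (b := T) (l := atTop) (F := fun k s => (inner ℝ (F s (u (σ k) s)) z : ℝ))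
    (fun _ => B * ‖z‖) ?_ ?_ intervalIntegrable_const
    (Eventually.of_forall fun t ht => hlim t (by
      rw [uIoc_of_le hT.le] at ht
      exact ⟨ht.1.le, ht.2⟩))
  · simp only [hzero] at hconv
    exact tendsto_nhds_unique hconv tendsto_const_nhds
  · refine Eventually.of_forall fun k => ?_
    rw [uIoc_of_le hT.le]
    exact (((hFc (σ k)).inner (𝕜 := ℝ) continuousOn_const).mono
      Ioc_subset_Icc_self).aestronglyMeasurable measurableSet_Ioc
  · refine Eventually.of_forall fun k => Eventually.of_forall fun t ht => ?_
    rw [uIoc_of_le hT.le] at ht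
    refine (norm_inner_le_norm _ _).trans ?_
    gcongr
    exact hB t ht.1.le _
end

section
/- Let Ω⊆ℝⁿ be an open bounded set, X = L²(Ω) (real), T>0, and {S(t)}_{t≥0} a compact C0 semigroup on X. Let λ∈ℝ and N_λ := {x∈X : e^{λT}S(T)x = x} be a nonzero subspace such that e^{λt}S(t)x = x and e^{λt}S(t)*x = x for every x∈N_λ and t≥0, where S(t)* is the Hilbert-space adjoint of S(t). Let f:[0,∞)×Ω×ℝ→ℝ be continuous satisfying conditions (a), (b), (c), (d) and let F be the associated Nemytskii operator. Assume that either (LL+): for every u∈N_λ with ‖u‖=1, ∫₀ᵀ∫_{{u>0}} f₊(t,x)u(x) dx dt + ∫₀ᵀ∫_{{u<0}} f₋(t,x)u(x) dx dt > 0, or (LL−): for every u∈N_λ with ‖u‖=1 this quantity is < 0. Then there exists a T-periodic mild solution: a continuous u:[0,∞)→X with u(t+T)=u(t) for all t≥0 and u(t) = e^{λt}S(t)u(0) + ∫₀ᵗ e^{λ(t−s)}S(t−s)F(s,u(s)) ds for all t≥0. -/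
open MeasureTheory Set Filter Topology Bornology intervalIntegral

open Polynomial in
/-- Extrapolation of polynomials of bounded degree from nodes in `(0, δ)` to the point `1`. -/
theorem exists_extrapolation (D : ℕ) {δ : ℝ} (hδ : 0 < δ) :
    ∃ (s : Finset ℝ) (c : ℝ → ℝ), (∀ t ∈ s, 0 < t ∧ t < δ) ∧
      ∀ p : ℝ[X], p.natDegree ≤ D → p.eval 1 = ∑ t ∈ s, c t * p.eval t := by
  obtain ⟨s, hs, hcard⟩ := (Set.Ioo_infinite hδ).exists_subset_card_eq (D + 1)
  refine ⟨s, fun t => (Lagrange.basis s id t).eval 1, fun t ht => hs ht, fun p hp => ?_⟩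
  have hdeg : p.degree < s.card :=
    lt_of_le_of_lt (degree_le_of_natDegree_le hp) (by rw [hcard]; exact_mod_cast Nat.lt_succ_self D)
  conv_lhs => rw [Lagrange.eq_interpolate (v := id) (Set.injOn_id _) hdeg]
  simp [Lagrange.interpolate_apply, eval_finsetSum, mul_comm]

open Polynomial in
theorem exists_polynomial_det_one_add_smul {E : Type*} [NormedAddCommGroup E] [NormedSpace ℝ E]
    [FiniteDimensional ℝ E] (A : E →L[ℝ] E) :
    ∃ p : ℝ[X], p.natDegree ≤ Module.finrank ℝ E ∧
      ∀ t : ℝ, p.eval t = (1 + t • A : E →L[ℝ] E).det := by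
  let b := Module.finBasis ℝ E
  let M := LinearMap.toMatrix b b (A : E →ₗ[ℝ] E)
  refine ⟨((X : ℝ[X]) • M.map C + (1 : Matrix _ _ ℝ).map C).det, ?_, fun t => ?_⟩
  · simpa using natDegree_det_X_add_C_le M 1
  · rw [ContinuousLinearMap.det, ← LinearMap.det_toMatrix b, ← coe_evalRingHom, RingHom.map_det]
    congr 1
    ext i j
    simp [M, Matrix.one_apply, LinearMap.toMatrix_apply, Module.Basis.repr_self,
      Finsupp.single_apply, apply_ite, add_comm, eq_comm]
    exact mul_comm _ _

section Brouwer

variable {E : Type*} [NormedAddCommGroup E] [InnerProductSpace ℝ E]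

open Polynomial in
theorem exists_polynomial_norm_add_smul_sq (q : ℝ[X]) (x y : E) :
    ∃ p : ℝ[X], p.natDegree ≤ q.natDegree * 2 ∧
      ∀ t : ℝ, p.eval t = q.eval (‖x + t • y‖ ^ 2) := by
  refine ⟨q.comp (C (‖x‖ ^ 2) + C (2 * inner ℝ x y) * X + C (‖y‖ ^ 2) * X ^ 2), ?_, fun t => ?_⟩
  · refine natDegree_comp_le.trans (Nat.mul_le_mul_left _ ?_)
    compute_degree
  · rw [norm_add_sq_real, inner_smul_right, norm_smul, mul_pow, Real.norm_eq_abs, sq_abs]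
    simp only [eval_comp, eval_add, eval_mul, eval_C, eval_X, eval_pow]
    ring_nf

theorem image_closedBall_of_small_perturbation [CompleteSpace E] {g : E → E} {K : NNReal}
    (hg : LipschitzWith K g) {R : ℝ} (hsupp : Function.support g ⊆ Metric.closedBall 0 R) {t : ℝ}
    (ht : 0 ≤ t) (htK : t * K < 1) :
    Function.Injective (fun x => x + t • g x) ∧
    (fun x => x + t • g x) '' Metric.closedBall 0 R = Metric.closedBall 0 R := by
  have hout : ∀ x, x ∉ Metric.closedBall (0 : E) R → x + t • g x = x := fun x hx => by
    rw [Function.notMem_support.1 (fun h => hx (hsupp h)), smul_zero, add_zero]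
  have happ : ApproximatesLinearOn (fun x => x + t • g x)
      ((ContinuousLinearEquiv.refl ℝ E : E ≃L[ℝ] E) : E →L[ℝ] E) univ
      (Real.toNNReal t * K) := by
    rw [ApproximatesLinearOn.approximatesLinearOn_iff_lipschitzOnWith]
    refine LipschitzOnWith.of_dist_le_mul fun x _ y _ => ?_
    have := hg.dist_le_mul x y
    simp only [Pi.sub_apply, ContinuousLinearEquiv.coe_refl, ContinuousLinearMap.id_apply,
      add_sub_cancel_left, dist_eq_norm, ← smul_sub, norm_smul, NNReal.coe_mul,
      Real.coe_toNNReal t ht, Real.norm_of_nonneg ht] at this ⊢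
    rw [mul_assoc]
    gcongr
  have hc : Subsingleton E ∨ Real.toNNReal t * K <
      ‖((ContinuousLinearEquiv.refl ℝ E).symm : E →L[ℝ] E)‖₊⁻¹ := by
    rcases subsingleton_or_nontrivial E with h | h
    · exact Or.inl h
    · refine Or.inr ?_
      have h1 : ‖((ContinuousLinearEquiv.refl ℝ E).symm : E →L[ℝ] E)‖₊ = 1 := by
        simp
      rw [h1, inv_one, ← NNReal.coe_lt_coe, NNReal.coe_mul, Real.coe_toNNReal t ht]
      exact htK
  have hinj : Function.Injective (fun x => x + t • g x) :=
    injOn_univ.1 (happ.injOn hc)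
  have hsurj : Function.Surjective (fun x => x + t • g x) := happ.surjective hc
  refine ⟨hinj, Subset.antisymm ?_ ?_⟩
  · rintro _ ⟨x, hx, rfl⟩
    by_contra h
    have := hinj (hout _ h)
    exact h (by simpa [this] using hx)
  · intro y hy
    obtain ⟨x, rfl⟩ := hsurj y
    refine ⟨x, ?_, rfl⟩
    by_contra h
    exact h (by simpa [hout x h] using hy)

theorem ContinuousLinearMap.exists_det_pos_near_one :
    ∃ η > 0, ∀ A : E →L[ℝ] E, ‖A‖ < η → 0 < (1 + A : E →L[ℝ] E).det := by
  have hc : Continuous fun A : E →L[ℝ] E => (1 + A : E →L[ℝ] E).det :=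
    ContinuousLinearMap.continuous_det.comp (continuous_const.add continuous_id)
  have h0 : (0 : ℝ) < (1 + (0 : E →L[ℝ] E) : E →L[ℝ] E).det := by
    rw [add_zero]
    simp [ContinuousLinearMap.det]
  have := hc.continuousAt.eventually (lt_mem_nhds h0)
  obtain ⟨η, hη, h⟩ := Metric.eventually_nhds_iff.1 this
  exact ⟨η, hη, fun A hA => h (by simpa using hA)⟩

section Perturbation

variable [FiniteDimensional ℝ E] [MeasurableSpace E] [BorelSpace E]

open Polynomial in
/-- Change of variables for a compactly supported `C¹` perturbation of the identity (a form of
the invariance of the degree). -/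
theorem integral_closedBall_comp_mul_det {g : E → E} (hg : ContDiff ℝ 1 g) {R : ℝ}
    (hsupp : Function.support g ⊆ Metric.closedBall 0 R) (q : ℝ[X]) :
    ∫ x in Metric.closedBall (0 : E) R, q.eval (‖x + g x‖ ^ 2) *
        (1 + fderiv ℝ g x : E →L[ℝ] E).det =
      ∫ x in Metric.closedBall (0 : E) R, q.eval (‖x‖ ^ 2) := by
  have hcs : HasCompactSupport g :=
    HasCompactSupport.of_support_subset_isCompact (isCompact_closedBall 0 R) hsupp
  obtain ⟨K, hK⟩ := hg.lipschitzWith_of_hasCompactSupport hcs one_ne_zero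
  obtain ⟨η, hη, hdet⟩ := ContinuousLinearMap.exists_det_pos_near_one (E := E)
  have hgd : ∀ x, HasFDerivAt g (fderiv ℝ g x) x := fun x =>
    (hg.differentiable one_ne_zero x).hasFDerivAt
  have hgc : Continuous (fderiv ℝ g) := hg.continuous_fderiv one_ne_zero
  obtain ⟨s, c, hs, hc⟩ := exists_extrapolation (q.natDegree * 2 + Module.finrank ℝ E)
    (δ := min 1 η / (K + 1)) (by positivity)
  have hsmall : ∀ t ∈ s, t * K < 1 ∧ t * K < η := fun t ht => by
    have h1 := (hs t ht).2
    rw [lt_div_iff₀ (by positivity)] at h1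
    have h2 : t * K < min 1 η := lt_of_le_of_lt (by nlinarith [(hs t ht).1]) h1
    exact lt_min_iff.1 h2
  let J : ℝ → E → ℝ := fun t x => q.eval (‖x + t • g x‖ ^ 2) *
    (1 + t • fderiv ℝ g x : E →L[ℝ] E).det
  have hJc : ∀ t, Continuous (J t) := fun t => by
    refine Continuous.mul (q.continuous.comp ?_) (ContinuousLinearMap.continuous_det.comp ?_)
    · have := hg.continuous
      fun_prop
    · fun_prop
  have hJi : ∀ t, IntegrableOn (J t) (Metric.closedBall (0 : E) R) := fun t =>
    (hJc t).continuousOn.integrableOn_compact (isCompact_closedBall 0 R)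
  have hJt : ∀ t ∈ s, ∫ x in Metric.closedBall (0 : E) R, J t x =
      ∫ x in Metric.closedBall (0 : E) R, q.eval (‖x‖ ^ 2) := fun t ht => by
    obtain ⟨hinj, himg⟩ :=
      image_closedBall_of_small_perturbation hK hsupp (hs t ht).1.le (hsmall t ht).1
    have hcv := integral_image_eq_integral_abs_det_fderiv_smul volume
      (s := Metric.closedBall (0 : E) R) (f := fun x => x + t • g x)
      (f' := fun x => (1 + t • fderiv ℝ g x : E →L[ℝ] E)) Metric.isClosed_closedBall.measurableSet
      (fun x _ => ((hasFDerivAt_id x).add ((hgd x).const_smul t)).hasFDerivWithinAt)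
      (hinj.injOn) (fun y => q.eval (‖y‖ ^ 2))
    rw [himg] at hcv
    rw [hcv]
    congr 1
    ext x
    have hpos : 0 < (1 + t • fderiv ℝ g x : E →L[ℝ] E).det := hdet _ (by
      rw [norm_smul, Real.norm_of_nonneg (hs t ht).1.le]
      exact lt_of_le_of_lt (mul_le_mul_of_nonneg_left (norm_fderiv_le_of_lipschitz ℝ hK)
        (hs t ht).1.le) (hsmall t ht).2)
    simp only [J]
    rw [abs_of_pos hpos, smul_eq_mul, mul_comm]
  have hJ1 : ∀ x, J 1 x = ∑ t ∈ s, c t * J t x := fun x => by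
    obtain ⟨p₁, hp₁, hp₁e⟩ := exists_polynomial_norm_add_smul_sq q x (g x)
    obtain ⟨p₂, hp₂, hp₂e⟩ := exists_polynomial_det_one_add_smul (fderiv ℝ g x)
    have := hc (p₁ * p₂) (natDegree_mul_le.trans (add_le_add hp₁ hp₂))
    simpa [hp₁e, hp₂e, J] using this
  have hc1 : ∑ t ∈ s, c t = 1 := by
    have := hc 1 (by simp)
    simpa using this.symm
  calc _ = ∫ x in Metric.closedBall (0 : E) R, J 1 x := by simp [J]
    _ = ∫ x in Metric.closedBall (0 : E) R, ∑ t ∈ s, c t * J t x := by simp_rw [hJ1]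
    _ = ∑ t ∈ s, c t * ∫ x in Metric.closedBall (0 : E) R, J t x := by
        rw [integral_finsetSum _ fun t _ => (hJi t).const_mul _]
        simp_rw [MeasureTheory.integral_const_mul]
    _ = _ := by
        rw [Finset.sum_congr rfl fun t ht => by rw [hJt t ht], ← Finset.sum_mul, hc1, one_mul]

open Polynomial in
theorem not_exists_pos_le_norm_of_contDiff {g : E → E} (hg : ContDiff ℝ 1 g) {R : ℝ} (hR : 0 < R)
    (hsupp : Function.support g ⊆ Metric.closedBall 0 R) {c : ℝ} (hc : 0 < c)
    (hφ : ∀ x, c ≤ ‖x + g x‖) : False := by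
  obtain ⟨M, hM⟩ := ((isCompact_closedBall (0 : E) R).image_of_continuousOn
    (f := fun x => ‖x + g x‖) (by have := hg.continuous; fun_prop)).bddAbove
  have hM' : ∀ x ∈ Metric.closedBall (0 : E) R, ‖x + g x‖ ≤ M := fun x hx => hM ⟨x, hx, rfl⟩
  let N := max M R
  have hcN : c ≤ N := (hφ 0).trans ((hM' 0 (by simp [hR.le])).trans (le_max_left _ _))
  have hN : 0 < N := hc.trans_le hcN
  let r := min (c / 2) R
  have hr : 0 < r := lt_min (by positivity) hR
  have hrc : r < c := lt_of_le_of_lt (min_le_left _ _) (by linarith)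
  let a := 1 - c ^ 2 / N ^ 2
  let b := 1 - r ^ 2 / N ^ 2
  have ha : 0 ≤ a := by
    simp only [a]; rw [sub_nonneg, div_le_one (by positivity)]; gcongr
  have hab : a < b := by
    simp only [a, b]; gcongr
  have hb : 0 < b := ha.trans_lt hab
  let A := ∫ x in Metric.closedBall (0 : E) R, |(1 + fderiv ℝ g x : E →L[ℝ] E).det|
  let V := volume.real (Metric.closedBall (0 : E) r)
  have hV : 0 < V := ENNReal.toReal_pos (Metric.measure_closedBall_pos volume _ hr).ne'
    (isCompact_closedBall _ _).measure_lt_top.ne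
  have hgc : Continuous (fderiv ℝ g) := hg.continuous_fderiv one_ne_zero
  have hdc : Continuous fun x => (1 + fderiv ℝ g x : E →L[ℝ] E).det :=
    ContinuousLinearMap.continuous_det.comp (continuous_const.add hgc)
  have hball := isCompact_closedBall (0 : E) R
  have key : ∀ k : ℕ, b ^ k * V ≤ a ^ k * A := fun k => by
    let q : ℝ[X] := (1 - C (1 / N ^ 2) * X) ^ k
    have hq : ∀ y : ℝ, q.eval y = (1 - y / N ^ 2) ^ k := fun y => by
      simp [q, div_eq_inv_mul]
    have hint := integral_closedBall_comp_mul_det hg hsupp q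
    simp_rw [hq] at hint
    have hnn : ∀ y : ℝ, 0 ≤ y → y ≤ N → 0 ≤ 1 - y ^ 2 / N ^ 2 := fun y hy hyN => by
      rw [sub_nonneg, div_le_one (by positivity)]; gcongr
    have hicont : Continuous fun x : E => (1 - ‖x‖ ^ 2 / N ^ 2) ^ k := by fun_prop
    calc b ^ k * V = ∫ x in Metric.closedBall (0 : E) r, b ^ k := by
          simp [V, mul_comm]
      _ ≤ ∫ x in Metric.closedBall (0 : E) r, (1 - ‖x‖ ^ 2 / N ^ 2) ^ k := by
          refine setIntegral_mono_on
            (continuous_const.continuousOn.integrableOn_compact (isCompact_closedBall 0 r))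
            (hicont.continuousOn.integrableOn_compact (isCompact_closedBall 0 r))
            Metric.isClosed_closedBall.measurableSet fun x hx => ?_
          have : ‖x‖ ≤ r := by simpa using hx
          simp only [b]
          gcongr
      _ ≤ ∫ x in Metric.closedBall (0 : E) R, (1 - ‖x‖ ^ 2 / N ^ 2) ^ k := by
          refine setIntegral_mono_set
            (hicont.continuousOn.integrableOn_compact (isCompact_closedBall 0 R)) ?_
            (Metric.closedBall_subset_closedBall (min_le_right _ _)).eventuallyLE
          refine (ae_restrict_iff' Metric.isClosed_closedBall.measurableSet).2 (ae_of_all _ ?_)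
          intro x hx
          have : ‖x‖ ≤ R := by simpa using hx
          exact pow_nonneg (hnn _ (norm_nonneg _) (this.trans (le_max_right _ _))) _
      _ = _ := hint.symm
      _ ≤ ∫ x in Metric.closedBall (0 : E) R,
            a ^ k * |(1 + fderiv ℝ g x : E →L[ℝ] E).det| := by
          refine setIntegral_mono_on ?_ ?_ Metric.isClosed_closedBall.measurableSet fun x hx => ?_
          · refine Continuous.continuousOn ?_ |>.integrableOn_compact (isCompact_closedBall 0 R)
            have := hg.continuous
            fun_prop
          · refine Continuous.continuousOn ?_ |>.integrableOn_compact (isCompact_closedBall 0 R)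
            fun_prop
          · have h1 := hnn _ (norm_nonneg _) ((hM' x hx).trans (le_max_left M R))
            refine (mul_le_mul_of_nonneg_left (le_abs_self _) (pow_nonneg h1 k)).trans ?_
            refine mul_le_mul_of_nonneg_right (pow_le_pow_left₀ h1 ?_ k) (abs_nonneg _)
            simp only [a]
            gcongr
            exact hφ x
      _ = a ^ k * A := by rw [MeasureTheory.integral_const_mul]
  have hlim : Tendsto (fun k : ℕ => (a / b) ^ k * A) atTop (𝓝 (0 * A)) :=
    (tendsto_pow_atTop_nhds_zero_of_lt_one (by positivity) ((div_lt_one hb).2 hab)).mul_const A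
  have : V ≤ 0 * A := ge_of_tendsto' hlim fun k => by
    rw [div_pow, div_mul_eq_mul_div, le_div_iff₀ (by positivity), mul_comm]
    exact key k
  linarith

end Perturbation

variable [FiniteDimensional ℝ E]

/-- A continuous compactly supported perturbation of the identity has a zero. -/
theorem exists_zero_of_support_subset {g : E → E} (hg : Continuous g) {R : ℝ} (hR : 0 < R)
    (hsupp : Function.support g ⊆ Metric.closedBall 0 R) : ∃ x, x + g x = 0 := by
  borelize E
  by_contra! hne
  obtain ⟨c, hc, hcb⟩ : ∃ c, 0 < c ∧ ∀ x ∈ Metric.closedBall (0 : E) R, c ≤ ‖x + g x‖ := by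
    obtain ⟨x₀, -, hx₀⟩ := (isCompact_closedBall (0 : E) R).exists_isMinOn
      ⟨0, by simp [hR.le]⟩ (f := fun x => ‖x + g x‖) (by fun_prop)
    exact ⟨_, norm_pos_iff.2 (hne x₀), fun x hx => hx₀ hx⟩
  obtain ⟨h, hh, hgh, hhs⟩ := hg.exists_contDiff_approx 1 (ε := fun _ => c / 2)
    continuous_const (fun _ => half_pos hc)
  refine not_exists_pos_le_norm_of_contDiff hh hR (hhs.trans hsupp)
    (c := min (c / 2) R) (lt_min (half_pos hc) hR) fun x => ?_
  by_cases hx : x ∈ Metric.closedBall (0 : E) R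
  · refine (min_le_left _ _).trans ?_
    have h1 := hcb x hx
    have h2 := hgh x
    rw [dist_comm, dist_eq_norm] at h2
    have h3 := norm_sub_norm_le (x + g x) (x + h x)
    rw [add_sub_add_left_eq_sub] at h3
    linarith
  · rw [Function.notMem_support.1 (fun h' => hx (hsupp (hhs h'))), add_zero]
    refine (min_le_right _ _).trans ?_
    simpa using (not_le.1 (by simpa using hx)).le

/-- **Brouwer's fixed point theorem** for bounded continuous self-maps of a Euclidean space. -/
theorem exists_fixedPoint_of_continuous_of_bounded {h : E → E} (hh : Continuous h) {R : ℝ}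
    (hb : ∀ x, ‖h x‖ ≤ R) : ∃ x, h x = x := by
  have hR : 0 ≤ R := (norm_nonneg _).trans (hb 0)
  let χ : E → ℝ := fun x => max 0 (min 1 (R + 1 - ‖x‖))
  obtain ⟨x, hx⟩ := exists_zero_of_support_subset (g := fun x => -(χ x • h x)) (R := R + 1)
    (by simp only [χ]; fun_prop) (by positivity) (by
      intro x hx
      by_contra hx'
      have : R + 1 - ‖x‖ ≤ 0 := by
        have : R + 1 < ‖x‖ := by simpa using hx'
        linarith
      have hχ : χ x = 0 := max_eq_left ((min_le_right _ _).trans this)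
      simp [hχ] at hx)
  have hx1 : x = χ x • h x := by rwa [← sub_eq_add_neg, sub_eq_zero] at hx
  have hχ0 : 0 ≤ χ x := le_max_left _ _
  have hχ1 : χ x ≤ 1 := max_le zero_le_one (min_le_left _ _)
  have hxR : ‖x‖ ≤ R := by
    rw [hx1, norm_smul, Real.norm_of_nonneg hχ0]
    exact (mul_le_of_le_one_left (norm_nonneg _) hχ1).trans (hb x)
  have : χ x = 1 := by
    simp only [χ]
    rw [min_eq_left (by linarith), max_eq_right zero_le_one]
  rw [this, one_smul] at hx1
  exact ⟨x, hx1.symm⟩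

end Brouwer

/-- **Schauder's fixed point theorem** for continuous self-maps of a Hilbert space with relatively
compact range. -/
theorem exists_fixedPoint_of_range_subset_isCompact {H : Type*} [NormedAddCommGroup H]
    [InnerProductSpace ℝ H] {Ψ : H → H} (hΨ : Continuous Ψ) {C : Set H} (hC : IsCompact C)
    (hrange : ∀ x, Ψ x ∈ C) : ∃ x, Ψ x = x := by
  have happrox : ∀ ε > 0, ∃ x, ‖Ψ x - x‖ ≤ ε := fun ε hε => by
    obtain ⟨s, hsC, hs, hcov⟩ := hC.finite_cover_balls hε
    let V := Submodule.span ℝ s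
    have : FiniteDimensional ℝ V := FiniteDimensional.span_of_finite ℝ hs
    obtain ⟨R, hR⟩ := hC.isBounded.exists_norm_le
    obtain ⟨x, hx⟩ := exists_fixedPoint_of_continuous_of_bounded
      (h := fun x : V => V.orthogonalProjectionOnto (Ψ x)) (by fun_prop) (R := R)
      (fun x => (V.norm_orthogonalProjectionOnto_apply_le _).trans (hR _ (hrange _)))
    refine ⟨x, ?_⟩
    obtain ⟨y, hy, hyd⟩ := mem_iUnion₂.1 (hcov (hrange x))
    have hmin := V.starProjection_minimal (Ψ x)
    have h1 : V.starProjection (Ψ x) = x := by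
      rw [Submodule.starProjection_apply, hx]
    rw [h1] at hmin
    rw [hmin]
    refine (ciInf_le ⟨0, ?_⟩ (⟨y, Submodule.subset_span hy⟩ : V)).trans ?_
    · rintro _ ⟨z, rfl⟩
      exact norm_nonneg _
    · rw [← dist_eq_norm]
      exact (Metric.mem_ball.1 hyd).le
  choose x hx using fun n : ℕ => happrox (1 / ((n : ℝ) + 1)) Nat.one_div_pos_of_nat
  obtain ⟨y, -, φ, hφ, hy⟩ := hC.tendsto_subseq (fun n => hrange (x n))
  have hd : Tendsto (fun n => Ψ (x (φ n)) - x (φ n)) atTop (𝓝 0) :=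
    squeeze_zero_norm (fun n => hx (φ n))
      (tendsto_one_div_add_atTop_nhds_zero_nat.comp hφ.tendsto_atTop)
  have hxy : Tendsto (fun n => x (φ n)) atTop (𝓝 y) := by
    simpa using hy.sub hd
  exact ⟨y, tendsto_nhds_unique ((hΨ.tendsto y).comp hxy) hy⟩

section MildSolution

variable {H : Type*} [NormedAddCommGroup H] [NormedSpace ℝ H]

theorem integral_exp_neg_mul_sub_le {κ : ℝ} (hκ : 0 < κ) (t : ℝ) :
    ∫ s in (0 : ℝ)..t, Real.exp (-κ * (t - s)) ≤ 1 / κ := by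
  have hd : ∀ s ∈ uIcc 0 t, HasDerivAt (fun s => Real.exp (-κ * (t - s)) / κ)
      (Real.exp (-κ * (t - s))) s := fun s _ => by
    have h1 : HasDerivAt (fun s => -κ * (t - s)) (-κ * (-1)) s :=
      ((hasDerivAt_id s).const_sub t).const_mul (-κ)
    exact (h1.exp.div_const κ).congr_deriv
      (by rw [neg_mul_neg, mul_one, mul_div_cancel_right₀ _ hκ.ne'])
  rw [integral_eq_sub_of_hasDerivAt hd
    (Continuous.intervalIntegrable (by fun_prop) _ _)]
  simp only [sub_self, mul_zero, Real.exp_zero]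
  have : 0 ≤ Real.exp (-κ * (t - 0)) / κ := by positivity
  linarith

theorem continuous_convolution_integrand {V : ℝ → H →L[ℝ] H}
    (hV : Continuous fun p : ℝ × H => V p.1 p.2) {w : ℝ → H} (hw : Continuous w) (t : ℝ) :
    Continuous fun s => V (t - s) (w s) :=
  hV.comp ((continuous_const.sub continuous_id).prodMk hw)

theorem continuous_convolution {V : ℝ → H →L[ℝ] H}
    (hV : Continuous fun p : ℝ × H => V p.1 p.2) {w : ℝ → H} (hw : Continuous w) {τ : ℝ → ℝ}
    (hτ : Continuous τ) :
    Continuous fun t => ∫ s in (0 : ℝ)..τ t, V (τ t - s) (w s) := by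
  refine continuous_parametric_intervalIntegral_of_continuous ?_ hτ
  exact hV.comp (((hτ.comp continuous_fst).sub continuous_snd).prodMk (hw.comp continuous_snd))

theorem norm_convolution_le {V : ℝ → H →L[ℝ] H} {C κ : ℝ} (hC : 0 ≤ C) (hκ : 0 < κ)
    (hVb : ∀ t, 0 ≤ t → ‖V t‖ ≤ C * Real.exp (-κ * t)) {w : ℝ → H} {D t : ℝ} (ht : 0 ≤ t)
    (hw : ∀ s, 0 ≤ s → s ≤ t → ‖w s‖ ≤ D) :
    ‖∫ s in (0 : ℝ)..t, V (t - s) (w s)‖ ≤ C * D / κ := by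
  have hD : 0 ≤ D := (norm_nonneg _).trans (hw 0 le_rfl ht)
  calc _ ≤ ∫ s in (0 : ℝ)..t, C * D * Real.exp (-κ * (t - s)) := by
        refine intervalIntegral.norm_integral_le_of_norm_le ht (ae_of_all _ fun s hs => ?_)
          (Continuous.intervalIntegrable (by fun_prop) _ _)
        calc _ ≤ ‖V (t - s)‖ * ‖w s‖ := (V (t - s)).le_opNorm _
          _ ≤ (C * Real.exp (-κ * (t - s))) * D :=
            mul_le_mul (hVb _ (by linarith [hs.2])) (hw s hs.1.le hs.2) (norm_nonneg _)
              (by positivity)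
          _ = _ := by ring
    _ = C * D * ∫ s in (0 : ℝ)..t, Real.exp (-κ * (t - s)) :=
        intervalIntegral.integral_const_mul _ _
    _ ≤ C * D * (1 / κ) := by gcongr; exact integral_exp_neg_mul_sub_le hκ t
    _ = _ := by ring

theorem norm_convolution_sub_le {V : ℝ → H →L[ℝ] H}
    (hV : Continuous fun p : ℝ × H => V p.1 p.2) {C κ : ℝ} (hC : 0 ≤ C) (hκ : 0 < κ)
    (hVb : ∀ t, 0 ≤ t → ‖V t‖ ≤ C * Real.exp (-κ * t)) {w₁ w₂ : ℝ → H}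
    (hw₁ : Continuous w₁) (hw₂ : Continuous w₂) {D t : ℝ} (ht : 0 ≤ t)
    (hw : ∀ s, 0 ≤ s → s ≤ t → ‖w₁ s - w₂ s‖ ≤ D) :
    ‖(∫ s in (0 : ℝ)..t, V (t - s) (w₁ s)) - ∫ s in (0 : ℝ)..t, V (t - s) (w₂ s)‖
      ≤ C * D / κ := by
  rw [← intervalIntegral.integral_sub
    ((continuous_convolution_integrand hV hw₁ t).intervalIntegrable _ _)
    ((continuous_convolution_integrand hV hw₂ t).intervalIntegrable _ _)]
  simp_rw [← map_sub]
  exact norm_convolution_le hC hκ hVb ht hw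

/-- `v` is a mild solution on `[0, ∞)` of `v' = Av + g(t, v)`, `v(0) = x`, where `A` generates
`V`. -/
def IsMildSolution (V : ℝ → H →L[ℝ] H) (g : ℝ → H → H) (x : H) (v : ℝ → H) : Prop :=
  ∀ t, 0 ≤ t → v t = V t x + ∫ s in (0 : ℝ)..t, V (t - s) (g s (v s))

theorem IsMildSolution.norm_sub_le_of_stable {V : ℝ → H →L[ℝ] H}
    (hV : Continuous fun p : ℝ × H => V p.1 p.2) {C κ : ℝ} (hC : 0 ≤ C) (hκ : 0 < κ)
    (hVb : ∀ t, 0 ≤ t → ‖V t‖ ≤ C * Real.exp (-κ * t)) {g : ℝ → H → H}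
    (hg : Continuous fun p : ℝ × H => g p.1 p.2) {M L : ℝ}
    (hgM : ∀ s, 0 ≤ s → ∀ v, ‖g s v‖ ≤ M) (hL : 0 ≤ L)
    (hgL : ∀ s, 0 ≤ s → ∀ v w, ‖g s v - g s w‖ ≤ L * ‖v - w‖) (hCL : C * L / κ ≤ 1 / 2)
    {x y : H} {v w : ℝ → H} (hvc : Continuous v) (hwc : Continuous w)
    (hv : IsMildSolution V g x v) (hw : IsMildSolution V g y w) {t : ℝ} (ht : 0 ≤ t) :
    ‖v t - w t‖ ≤ 2 * C * ‖x - y‖ := by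
  have hgv : Continuous fun s => g s (v s) := hg.comp (continuous_id.prodMk hvc)
  have hgw : Continuous fun s => g s (w s) := hg.comp (continuous_id.prodMk hwc)
  have hstep : ∀ D, (∀ s, 0 ≤ s → ‖g s (v s) - g s (w s)‖ ≤ D) → ∀ s, 0 ≤ s →
      ‖v s - w s‖ ≤ C * ‖x - y‖ + C * D / κ := fun D hD s hs => by
    rw [hv s hs, hw s hs, add_sub_add_comm, ← map_sub]
    refine (norm_add_le _ _).trans (add_le_add ?_ ?_)
    · refine ((V s).le_opNorm _).trans ?_
      refine mul_le_mul_of_nonneg_right ((hVb s hs).trans ?_) (norm_nonneg _)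
      refine mul_le_of_le_one_right hC (Real.exp_le_one_iff.2 ?_)
      nlinarith
    · exact norm_convolution_sub_le hV hC hκ hVb hgv hgw hs fun r hr _ => hD r hr
  have hbdd : BddAbove (range fun s : Ici (0 : ℝ) => ‖v s - w s‖) := by
    refine ⟨C * ‖x - y‖ + C * (2 * M) / κ, ?_⟩
    rintro _ ⟨s, rfl⟩
    refine hstep (2 * M) (fun r hr => ?_) s s.2
    exact (norm_sub_le _ _).trans (by linarith [hgM r hr (v r), hgM r hr (w r)])
  set D := ⨆ s : Ici (0 : ℝ), ‖v s - w s‖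
  have hD : ∀ s, 0 ≤ s → ‖v s - w s‖ ≤ D := fun s hs => le_ciSup hbdd (⟨s, hs⟩ : Ici (0 : ℝ))
  have hD0 : 0 ≤ D := (norm_nonneg _).trans (hD 0 le_rfl)
  have hDD : D ≤ C * ‖x - y‖ + C * (L * D) / κ := by
    have : Nonempty (Ici (0 : ℝ)) := ⟨⟨0, mem_Ici.2 le_rfl⟩⟩
    refine ciSup_le fun s => hstep (L * D) (fun r hr => ?_) s s.2
    exact (hgL r hr _ _).trans (by gcongr; exact hD r hr)
  have : C * (L * D) / κ = C * L / κ * D := by ring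
  have h2 : C * L / κ * D ≤ 1 / 2 * D := by gcongr
  linarith [hD t ht]

theorem exists_isMildSolution_of_stable [CompleteSpace H] {V : ℝ → H →L[ℝ] H}
    (hV : Continuous fun p : ℝ × H => V p.1 p.2) {C κ : ℝ} (hC : 0 ≤ C) (hκ : 0 < κ)
    (hVb : ∀ t, 0 ≤ t → ‖V t‖ ≤ C * Real.exp (-κ * t)) {g : ℝ → H → H}
    (hg : Continuous fun p : ℝ × H => g p.1 p.2) {M L : ℝ}
    (hgM : ∀ s, 0 ≤ s → ∀ v, ‖g s v‖ ≤ M) (hL : 0 ≤ L)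
    (hgL : ∀ s, 0 ≤ s → ∀ v w, ‖g s v - g s w‖ ≤ L * ‖v - w‖) (hCL : C * L / κ ≤ 1 / 2)
    (x : H) : ∃ v : ℝ → H, Continuous v ∧ IsMildSolution V g x v := by
  have hgc : ∀ v : ℝ → H, Continuous v → Continuous fun s => g s (v s) :=
    fun v hv => hg.comp (continuous_id.prodMk hv)
  have hmax : Continuous fun t : ℝ => max t 0 := by fun_prop
  let K : BoundedContinuousFunction ℝ H → BoundedContinuousFunction ℝ H := fun v =>
    BoundedContinuousFunction.ofNormedAddCommGroup
      (fun t => V (max t 0) x + ∫ s in (0 : ℝ)..max t 0, V (max t 0 - s) (g s (v s)))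
      ((hV.comp (hmax.prodMk continuous_const)).add
        (continuous_convolution hV (hgc v v.continuous) hmax))
      (C * ‖x‖ + C * M / κ) (fun t => by
        refine (norm_add_le _ _).trans (add_le_add ?_ ?_)
        · refine ((V _).le_opNorm _).trans ?_
          refine mul_le_mul_of_nonneg_right ((hVb _ (le_max_right _ _)).trans ?_) (norm_nonneg _)
          refine mul_le_of_le_one_right hC (Real.exp_le_one_iff.2 ?_)
          nlinarith [le_max_right t 0]
        · exact norm_convolution_le hC hκ hVb (le_max_right _ _) fun s hs _ => hgM s hs _)
  have hK : ContractingWith (1 / 2) K := by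
    refine ⟨by norm_num, LipschitzWith.of_dist_le_mul fun v w => ?_⟩
    rw [BoundedContinuousFunction.dist_le (by positivity)]
    intro t
    simp only [K, BoundedContinuousFunction.coe_ofNormedAddCommGroup, dist_eq_norm,
      add_sub_add_left_eq_sub]
    have := norm_convolution_sub_le hV hC hκ hVb (hgc v v.continuous) (hgc w w.continuous)
      (D := L * ‖v - w‖) (le_max_right t 0) (fun s hs _ => (hgL s hs _ _).trans (by
        gcongr
        exact (v - w).norm_coe_le_norm s))
    refine this.trans ?_
    have h1 : C * (L * ‖v - w‖) / κ = C * L / κ * ‖v - w‖ := by ring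
    rw [h1]
    have : ((1 / 2 : NNReal) : ℝ) = 1 / 2 := by norm_num
    rw [this]
    gcongr
  obtain ⟨v, hv⟩ : ∃ v, K v = v := ⟨_, hK.fixedPoint_isFixedPt⟩
  refine ⟨v, v.continuous, fun t ht => ?_⟩
  have := congrArg (fun u => u t) hv
  simpa [K, max_eq_left ht] using this.symm

/-- Rescaling by `exp (-k t)` turns mild solutions into mild solutions. -/
theorem isMildSolution_exp_smul_iff {U : ℝ → H →L[ℝ] H} {G : ℝ → H → H} {k : ℝ} {x : H}
    {u : ℝ → H} :
    IsMildSolution (fun t => Real.exp (-k * max t 0) • U t)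
      (fun s v => Real.exp (-k * s) • G s (Real.exp (k * s) • v)) x
      (fun t => Real.exp (-k * t) • u t) ↔ IsMildSolution U G x u := by
  refine forall₂_congr fun t ht => ?_
  have h1 : ∫ s in (0 : ℝ)..t, (Real.exp (-k * max (t - s) 0) • U (t - s))
      (Real.exp (-k * s) • G s (Real.exp (k * s) • (Real.exp (-k * s) • u s))) =
      Real.exp (-k * t) • ∫ s in (0 : ℝ)..t, U (t - s) (G s (u s)) := by
    rw [← intervalIntegral.integral_smul]
    refine intervalIntegral.integral_congr fun s hs => ?_
    rw [uIcc_of_le ht] at hs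
    simp only [_root_.smul_apply, map_smul, smul_smul, ← Real.exp_add]
    rw [max_eq_left (by linarith [hs.2])]
    ring_nf
    simp
  rw [h1]
  beta_reduce
  rw [max_eq_left ht, _root_.smul_apply, ← smul_add,
    (smul_right_injective H (Real.exp_pos (-k * t)).ne').eq_iff]

/-- Global well-posedness for a bounded Lipschitz perturbation of a `C₀` semigroup. -/
theorem exists_solution_map [CompleteSpace H] {U : ℝ → H →L[ℝ] H}
    (hU : Continuous fun p : ℝ × H => U p.1 p.2) {C ω : ℝ} (hC : 0 ≤ C)
    (hUb : ∀ t, 0 ≤ t → ‖U t‖ ≤ C * Real.exp (ω * t)) {G : ℝ → H → H}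
    (hG : Continuous fun p : ℝ × H => G p.1 p.2) {M L : ℝ}
    (hGM : ∀ s v, ‖G s v‖ ≤ M) (hL : 0 ≤ L)
    (hGL : ∀ s v w, ‖G s v - G s w‖ ≤ L * ‖v - w‖) :
    (∀ x, ∃ u, Continuous u ∧ IsMildSolution U G x u) ∧
    ∃ k : ℝ, ∀ x y u v, Continuous u → Continuous v → IsMildSolution U G x u →
      IsMildSolution U G y v → ∀ t, 0 ≤ t → ‖u t - v t‖ ≤ 2 * C * Real.exp (k * t) * ‖x - y‖ := by
  let κ := 2 * C * L + 1
  let k := max (ω + κ) 0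
  have hκ : 0 < κ := by positivity
  have hk : 0 ≤ k := le_max_right _ _
  let V : ℝ → H →L[ℝ] H := fun t => Real.exp (-k * max t 0) • U t
  let g : ℝ → H → H := fun s v => Real.exp (-k * s) • G s (Real.exp (k * s) • v)
  have hV : Continuous fun p : ℝ × H => V p.1 p.2 := by
    simp only [V, _root_.smul_apply]
    fun_prop
  have hg : Continuous fun p : ℝ × H => g p.1 p.2 := by
    simp only [g]
    refine Continuous.smul (by fun_prop) (hG.comp (f := fun p : ℝ × H =>
      (p.1, Real.exp (k * p.1) • p.2)) (by fun_prop))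
  have hVb : ∀ t, 0 ≤ t → ‖V t‖ ≤ C * Real.exp (-κ * t) := fun t ht => by
    simp only [V]
    rw [norm_smul, Real.norm_of_nonneg (Real.exp_pos _).le, max_eq_left ht]
    calc _ ≤ Real.exp (-k * t) * (C * Real.exp (ω * t)) := by gcongr; exact hUb t ht
      _ = C * Real.exp (-k * t + ω * t) := by rw [Real.exp_add]; ring
      _ ≤ _ := by
        gcongr
        nlinarith [le_max_left (ω + κ) 0]
  have hgM : ∀ s, 0 ≤ s → ∀ v, ‖g s v‖ ≤ M := fun s hs v => by
    simp only [g]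
    rw [norm_smul, Real.norm_of_nonneg (Real.exp_pos _).le]
    refine (mul_le_of_le_one_left (norm_nonneg _) (Real.exp_le_one_iff.2 ?_)).trans (hGM _ _)
    nlinarith
  have hgL : ∀ s, 0 ≤ s → ∀ v w, ‖g s v - g s w‖ ≤ L * ‖v - w‖ := fun s hs v w => by
    simp only [g]
    rw [← smul_sub, norm_smul, Real.norm_of_nonneg (Real.exp_pos _).le]
    calc _ ≤ Real.exp (-k * s) * (L * ‖Real.exp (k * s) • v - Real.exp (k * s) • w‖) := by
          gcongr; exact hGL _ _ _
      _ = (Real.exp (-k * s) * Real.exp (k * s)) * (L * ‖v - w‖) := by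
          rw [← smul_sub, norm_smul, Real.norm_of_nonneg (Real.exp_pos _).le]; ring
      _ = _ := by rw [← Real.exp_add]; simp
  have hCL : C * L / κ ≤ 1 / 2 := by
    rw [div_le_iff₀ hκ]; simp only [κ]; linarith
  refine ⟨fun x => ?_, k, fun x y u v hu hv hux hvy t ht => ?_⟩
  · obtain ⟨v, hv, hvs⟩ := exists_isMildSolution_of_stable hV hC hκ hVb hg hgM hL hgL hCL x
    refine ⟨fun t => Real.exp (k * t) • v t, by fun_prop, ?_⟩
    rw [← isMildSolution_exp_smul_iff (k := k)]
    convert hvs using 2 with t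
    rw [smul_smul, ← Real.exp_add]
    simp
  · have := IsMildSolution.norm_sub_le_of_stable hV hC hκ hVb hg hgM hL hgL hCL
      (v := fun t => Real.exp (-k * t) • u t) (w := fun t => Real.exp (-k * t) • v t)
      (by fun_prop) (by fun_prop) (isMildSolution_exp_smul_iff.2 hux)
      (isMildSolution_exp_smul_iff.2 hvy) ht
    rw [← smul_sub, norm_smul, Real.norm_of_nonneg (Real.exp_pos _).le] at this
    calc ‖u t - v t‖ = Real.exp (k * t) * (Real.exp (-k * t) * ‖u t - v t‖) := by
          rw [← mul_assoc, ← Real.exp_add]; simp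
      _ ≤ Real.exp (k * t) * (2 * C * ‖x - y‖) := by gcongr
      _ = _ := by ring

end MildSolution

section Semigroup

variable {H : Type*} [NormedAddCommGroup H] [NormedSpace ℝ H]

theorem exists_norm_le_on_Icc [CompleteSpace H] {U : ℝ → H →L[ℝ] H}
    (hU : ∀ x, Continuous fun t => U t x) (a b : ℝ) :
    ∃ C, ∀ t ∈ Icc a b, ‖U t‖ ≤ C := by
  obtain ⟨C, hC⟩ := banach_steinhaus (g := fun t : Icc a b => U t) fun x => by
    obtain ⟨C, hC⟩ := (isCompact_Icc (a := a) (b := b)).exists_bound_of_continuousOn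
      (hU x).continuousOn
    exact ⟨C, fun t => hC t t.2⟩
  exact ⟨C, fun t ht => hC ⟨t, ht⟩⟩

theorem continuous_uncurry_of_strongly_continuous [CompleteSpace H] {U : ℝ → H →L[ℝ] H}
    (hU : ∀ x, Continuous fun t => U t x) : Continuous fun p : ℝ × H => U p.1 p.2 := by
  rw [continuous_iff_continuousAt]
  rintro ⟨t₀, x₀⟩
  obtain ⟨C, hC⟩ := exists_norm_le_on_Icc hU (t₀ - 1) (t₀ + 1)
  have hlip : ∀ t ∈ Icc (t₀ - 1) (t₀ + 1), LipschitzOnWith (Real.toNNReal C) (U t) univ :=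
    fun t ht => ((U t).lipschitz.weaken (by
      rw [← NNReal.coe_le_coe]; exact (hC t ht).trans (Real.le_coe_toNNReal C))).lipschitzOnWith
  have := continuousOn_prod_of_continuousOn_lipschitzOnWith' (fun p : ℝ × H => U p.1 p.2)
    (Real.toNNReal C) (s := Icc (t₀ - 1) (t₀ + 1)) (t := univ)
    hlip (fun x _ => (hU x).continuousOn)
  exact this.continuousAt (prod_mem_nhds (Icc_mem_nhds (by linarith) (by linarith)) univ_mem)

theorem exists_exp_growth_bound [CompleteSpace H] {U : ℝ → H →L[ℝ] H}
    (hU : ∀ x, Continuous fun t => U t x)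
    (hadd : ∀ t s, 0 ≤ t → 0 ≤ s → U (t + s) = (U t).comp (U s)) :
    ∃ C ω : ℝ, 0 ≤ C ∧ 0 ≤ ω ∧ ∀ t, 0 ≤ t → ‖U t‖ ≤ C * Real.exp (ω * t) := by
  obtain ⟨C₀, hC₀⟩ := exists_norm_le_on_Icc hU 0 1
  let C := max C₀ 1
  have hC1 : 1 ≤ C := le_max_right _ _
  have hC : ∀ t ∈ Icc (0 : ℝ) 1, ‖U t‖ ≤ C := fun t ht => (hC₀ t ht).trans (le_max_left _ _)
  have hn : ∀ n : ℕ, ∀ r ∈ Icc (0 : ℝ) 1, ‖U (n + r)‖ ≤ C ^ n * C := by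
    intro n
    induction n with
    | zero => simpa using hC
    | succ n ih =>
      intro r hr
      have : ((n + 1 : ℕ) : ℝ) + r = 1 + (n + r) := by push_cast; ring
      rw [this, hadd 1 _ zero_le_one (add_nonneg n.cast_nonneg hr.1), pow_succ' C n, mul_assoc]
      exact ((U 1).opNorm_comp_le _).trans (mul_le_mul (hC 1 (by simp)) (ih r hr)
        (norm_nonneg _) (by positivity))
  refine ⟨C, Real.log C, by positivity, Real.log_nonneg hC1, fun t ht => ?_⟩
  have h1 := hn ⌊t⌋₊ (t - ⌊t⌋₊) ⟨by linarith [Nat.floor_le ht],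
    by linarith [Nat.lt_floor_add_one t]⟩
  rw [add_sub_cancel] at h1
  refine h1.trans ?_
  rw [mul_comm]
  gcongr
  rw [← Real.rpow_natCast, Real.rpow_def_of_pos (by positivity)]
  gcongr
  · exact Real.log_nonneg hC1
  · exact Nat.floor_le ht

/-- The time-`T` translate of a mild solution of a `T`-periodic problem is a mild solution. -/
theorem IsMildSolution.translate [CompleteSpace H] {U : ℝ → H →L[ℝ] H}
    (hU : Continuous fun p : ℝ × H => U p.1 p.2)
    (hadd : ∀ t s, 0 ≤ t → 0 ≤ s → U (t + s) = (U t).comp (U s)) {T : ℝ} (hT : 0 ≤ T)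
    {G : ℝ → H → H} (hG : Continuous fun p : ℝ × H => G p.1 p.2)
    (hper : ∀ s, 0 ≤ s → ∀ v, G (s + T) v = G s v) {x : H} {u : ℝ → H} (huc : Continuous u)
    (hu : IsMildSolution U G x u) : IsMildSolution U G (u T) (fun t => u (t + T)) := by
  intro t ht
  have hGc : Continuous fun s => G s (u s) := hG.comp (continuous_id.prodMk huc)
  have hint : ∀ r a b : ℝ, IntervalIntegrable (fun s => U (r - s) (G s (u s))) volume a b :=
    fun r a b => (continuous_convolution_integrand hU hGc r).intervalIntegrable _ _
  beta_reduce
  rw [hu (t + T) (add_nonneg ht hT), hu T hT, map_add, hadd t T ht hT,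
    ← intervalIntegral.integral_add_adjacent_intervals (hint _ 0 T) (hint _ T (t + T)), ← add_assoc]
  congr 1
  · congr 1
    rw [← ContinuousLinearMap.intervalIntegral_comp_comm _ (hint T 0 T)]
    refine intervalIntegral.integral_congr fun s hs => ?_
    rw [uIcc_of_le hT] at hs
    have : t + T - s = t + (T - s) := by ring
    simp only [this, hadd t (T - s) ht (by linarith [hs.2]), ContinuousLinearMap.comp_apply]
  · have h := intervalIntegral.integral_comp_add_right (a := 0) (b := t)
      (fun s => U (t + T - s) (G s (u s))) T
    rw [zero_add] at h
    rw [← h]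
    refine intervalIntegral.integral_congr fun s hs => ?_
    rw [uIcc_of_le ht] at hs
    simp only [hper s hs.1, add_sub_add_right_eq_sub]

/-- The Duhamel integrals at time `T` of bounded forcings form a relatively compact set. -/
theorem exists_isCompact_convolution_mem [CompleteSpace H] {U : ℝ → H →L[ℝ] H}
    (hU : Continuous fun p : ℝ × H => U p.1 p.2)
    (hadd : ∀ t s, 0 ≤ t → 0 ≤ s → U (t + s) = (U t).comp (U s))
    (hcomp : ∀ t, 0 < t → IsCompactOperator (U t)) {T : ℝ} (hT : 0 < T) (M : ℝ) :
    ∃ K : Set H, IsCompact K ∧ ∀ w : ℝ → H, Continuous w → (∀ s, ‖w s‖ ≤ M) →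
      ∫ s in (0 : ℝ)..T, U (T - s) (w s) ∈ K := by
  let K := {y | ∃ w : ℝ → H, Continuous w ∧ (∀ s, ‖w s‖ ≤ M) ∧
    ∫ s in (0 : ℝ)..T, U (T - s) (w s) = y}
  suffices TotallyBounded K from
    ⟨closure K, this.closure.isCompact_of_isClosed isClosed_closure,
      fun w hw hwM => subset_closure ⟨w, hw, hwM, rfl⟩⟩
  obtain ⟨C₀, hC₀⟩ := exists_norm_le_on_Icc
    (U := U)
    (fun x => hU.comp (continuous_id.prodMk (continuous_const (y := x)))) 0 T
  let C := max C₀ 0 * max M 0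
  have hC : 0 ≤ C := by positivity
  have hbound : ∀ w : ℝ → H, (∀ s, ‖w s‖ ≤ M) → ∀ r ∈ Icc 0 T, ‖U r‖ * ‖w (T - r)‖ ≤ C :=
    fun w hw r hr => mul_le_mul ((hC₀ r hr).trans (le_max_left _ _))
      ((hw _).trans (le_max_left _ _)) (norm_nonneg _) (le_max_right _ _)
  rw [Metric.totallyBounded_iff]
  intro ε hε
  let h := min (T / 2) (ε / (2 * (C + 1)))
  have hh : 0 < h := by positivity
  have hhT : h ≤ T := (min_le_left _ _).trans (by linarith)
  have hCh : C * h < ε / 2 := by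
    calc C * h ≤ C * (ε / (2 * (C + 1))) := by gcongr; exact min_le_right _ _
      _ < (C + 1) * (ε / (2 * (C + 1))) := by gcongr; linarith
      _ = ε / 2 := by field_simp
  obtain ⟨A, hA, hAs⟩ := (hcomp h hh).image_closedBall_subset_compact (f := (U h : H →ₗ[ℝ] H))
    (C * (T - h))
  obtain ⟨s, hs, hcov⟩ := Metric.totallyBounded_iff.1 hA.totallyBounded (ε / 2) (half_pos hε)
  refine ⟨s, hs, ?_⟩
  rintro _ ⟨w, hw, hwM, rfl⟩
  have hint : ∀ r a b : ℝ, IntervalIntegrable (fun s => U (r - s) (w s)) volume a b :=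
    fun r a b => (continuous_convolution_integrand hU hw r).intervalIntegrable _ _
  have hsplit := intervalIntegral.integral_add_adjacent_intervals
    (hint T 0 (T - h)) (hint T (T - h) T)
  have h1 : ∫ s in (0 : ℝ)..(T - h), U (T - s) (w s) =
      U h (∫ s in (0 : ℝ)..(T - h), U (T - h - s) (w s)) := by
    rw [← ContinuousLinearMap.intervalIntegral_comp_comm _ (hint (T - h) 0 (T - h))]
    refine intervalIntegral.integral_congr fun s hs => ?_
    rw [uIcc_of_le (by linarith)] at hs
    have : T - s = h + (T - h - s) := by ring
    simp only [this, hadd h (T - h - s) hh.le (by linarith [hs.2]), ContinuousLinearMap.comp_apply]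
  have h2 : ‖∫ s in (T - h)..T, U (T - s) (w s)‖ ≤ C * h := by
    have := intervalIntegral.norm_integral_le_of_norm_le_const (a := T - h) (b := T)
      (f := fun s => U (T - s) (w s)) (C := C) fun s hs => by
        rw [uIoc_of_le (by linarith)] at hs
        refine ((U (T - s)).le_opNorm _).trans ?_
        have := hbound w hwM (T - s) ⟨by linarith [hs.2], by linarith [hs.1]⟩
        rwa [sub_sub_cancel] at this
    rwa [sub_sub_cancel, abs_of_pos hh] at this
  have h3 : ‖∫ s in (0 : ℝ)..(T - h), U (T - h - s) (w s)‖ ≤ C * (T - h) := by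
    have := intervalIntegral.norm_integral_le_of_norm_le_const (a := 0) (b := T - h)
      (f := fun s => U (T - h - s) (w s)) (C := C) fun s hs => by
        rw [uIoc_of_le (by linarith)] at hs
        refine ((U (T - h - s)).le_opNorm _).trans ?_
        refine mul_le_mul ((hC₀ _ ⟨?_, ?_⟩).trans (le_max_left _ _))
          ((hwM _).trans (le_max_left _ _)) (norm_nonneg _) (le_max_right _ _) <;>
        linarith [hs.1, hs.2]
    rwa [sub_zero, abs_of_nonneg (by linarith)] at this
  obtain ⟨y, hy, hyd⟩ := mem_iUnion₂.1 (hcov (hAs ⟨_, mem_closedBall_zero_iff.2 h3, rfl⟩))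
  refine mem_iUnion₂.2 ⟨y, hy, ?_⟩
  rw [Metric.mem_ball, dist_eq_norm] at hyd ⊢
  rw [← hsplit, h1, add_sub_right_comm]
  exact (norm_add_le _ _).trans_lt (by
    simp only [ContinuousLinearMap.coe_coe] at hyd
    linarith)

end Semigroup

section Resonance

variable {H : Type*} [NormedAddCommGroup H] [InnerProductSpace ℝ H]

/-- Radial retraction onto the closed ball of radius `R`. -/
noncomputable def radialRetraction (R : ℝ) (v : H) : H := (R / max R ‖v‖) • v

theorem continuous_radialRetraction {R : ℝ} (hR : 0 < R) :
    Continuous (radialRetraction R : H → H) := by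
  unfold radialRetraction
  refine Continuous.smul (continuous_const.div (by fun_prop) fun v => ?_) continuous_id
  exact (hR.trans_le (le_max_left _ _)).ne'

theorem norm_radialRetraction_le {R : ℝ} (hR : 0 < R) (v : H) : ‖radialRetraction R v‖ ≤ R := by
  have hm : 0 < max R ‖v‖ := hR.trans_le (le_max_left _ _)
  rw [radialRetraction, norm_smul, Real.norm_of_nonneg (by positivity), div_mul_eq_mul_div,
    div_le_iff₀ hm]
  gcongr
  exact le_max_right _ _

/-- If `v - σ w` is retracted to `v`, where `w` points strictly outwards (after multiplication by
`σ`) whenever `v` lies on the sphere, then `w = 0`. -/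
theorem eq_zero_of_radialRetraction_eq {R : ℝ} (hR : 0 < R) {σ : ℝ} (hσ : σ ≠ 0) {v w : H}
    (h : radialRetraction R (v - σ • w) = v) (hw : ‖v‖ = R → 0 < σ * inner ℝ w v) : w = 0 := by
  unfold radialRetraction at h
  rcases le_or_gt ‖v - σ • w‖ R with hle | hlt
  · rw [max_eq_left hle, div_self hR.ne', one_smul, sub_eq_self, smul_eq_zero] at h
    exact h.resolve_left hσ
  · exfalso
    rw [max_eq_right hlt.le] at h
    set r := ‖v - σ • w‖
    have hr : 0 < r := hR.trans hlt
    have hnorm : ‖v‖ = R := by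
      rw [← h, norm_smul, Real.norm_of_nonneg (by positivity)]
      exact div_mul_cancel₀ _ hr.ne'
    have hpos := hw hnorm
    have h2 : v - σ • w = (r / R) • v := by
      conv_rhs => rw [← h]
      rw [smul_smul, div_mul_div_cancel₀ hR.ne', div_self hr.ne', one_smul]
    have h3 : inner ℝ (v - σ • w) v = r / R * (R * R) := by
      rw [h2, inner_smul_left, real_inner_self_eq_norm_mul_norm, hnorm]; simp
    rw [inner_sub_left, inner_smul_left, real_inner_self_eq_norm_mul_norm, hnorm] at h3
    simp only [conj_trivial] at h3
    have h4 : r / R * (R * R) = r * R := by field_simp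
    nlinarith

variable [CompleteSpace H]

/-- If `B` is compact and both `B` and its adjoint fix `ker (1 - B)`, then `1 - B + P` is
invertible, where `P` is the orthogonal projection onto `ker (1 - B)`. -/
theorem exists_rightInverse_one_sub_add_projection {B : H →L[ℝ] H} (hB : IsCompactOperator B)
    {N : Submodule ℝ H} [N.HasOrthogonalProjection] (hN : ∀ x, x ∈ N ↔ B x = x)
    (hadj : ∀ x ∈ N, ∀ y, inner ℝ (B y) x = inner ℝ y x) :
    ∃ A : H →L[ℝ] H, ∀ w, A w - B (A w) + N.starProjection (A w) = w := by
  have hP : IsCompactOperator N.starProjection := by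
    have : (N.starProjection : H → H) = B ∘ N.starProjection := by
      ext x
      exact ((hN _).1 (N.starProjection_apply_mem x)).symm
    rw [this]
    exact hB.comp_clm _
  have hK : IsCompactOperator (B - N.starProjection : H →L[ℝ] H) := hB.sub hP
  have hne : ¬ Module.End.HasEigenvalue
      ((B - N.starProjection : H →L[ℝ] H) : Module.End ℝ H) 1 := by
    intro h
    obtain ⟨x, hx⟩ := h.exists_hasEigenvector
    have hx1 : B x - N.starProjection x = x := by simpa using hx.apply_eq_smul
    have hPx : N.starProjection x = 0 := by
      have h1 := hadj _ (N.starProjection_apply_mem x) x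
      have h2 : inner ℝ (N.starProjection x) (N.starProjection x) = (0 : ℝ) := by
        have : N.starProjection x = B x - x := by
          rw [← sub_eq_iff_eq_add'.2 (sub_eq_iff_eq_add.1 hx1)]
        nth_rewrite 1 [this]
        rw [inner_sub_left, h1, sub_self]
      exact inner_self_eq_zero.1 h2
    rw [hPx, sub_zero] at hx1
    exact hx.2 (by rw [← (N.starProjection_eq_self_iff).2 ((hN x).2 hx1), hPx])
  have hres := (hK.hasEigenvalue_or_mem_resolventSet one_ne_zero).resolve_left hne
  rw [spectrum.mem_resolventSet_iff] at hres
  obtain ⟨A, hA⟩ := hres.exists_right_inv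
  refine ⟨A, fun w => ?_⟩
  have := congrArg (fun f : H →L[ℝ] H => f w) hA
  simp only [map_one, mul_apply_eq_comp, _root_.sub_apply,
    one_apply_eq_self] at this
  rw [← sub_add] at this
  exact this

theorem exists_periodic_isMildSolution {U : ℝ → H →L[ℝ] H}
    (hU : Continuous fun p : ℝ × H => U p.1 p.2)
    (hadd : ∀ t s, 0 ≤ t → 0 ≤ s → U (t + s) = (U t).comp (U s))
    (hcomp : ∀ t, 0 < t → IsCompactOperator (U t)) {T : ℝ} (hT : 0 < T)
    (N : Submodule ℝ H) [N.HasOrthogonalProjection] (hN : ∀ x, x ∈ N ↔ U T x = x)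
    (hfix : ∀ x ∈ N, ∀ t, 0 ≤ t → U t x = x)
    (hadj : ∀ x ∈ N, ∀ t, 0 ≤ t → ∀ y, inner ℝ (U t y) x = inner ℝ y x)
    {G : ℝ → H → H} (hG : Continuous fun p : ℝ × H => G p.1 p.2) {M L : ℝ}
    (hGM : ∀ s v, ‖G s v‖ ≤ M) (hL : 0 ≤ L)
    (hGL : ∀ s v w, ‖G s v - G s w‖ ≤ L * ‖v - w‖)
    (hper : ∀ s, 0 ≤ s → ∀ v, G (s + T) v = G s v) {σ : ℝ} (hσ : σ ≠ 0)
    (hLL : ∀ D, ∃ R > 0, ∀ u : ℝ → H, Continuous u → ∀ z ∈ N, ‖z‖ = R →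
      (∀ s ∈ Icc 0 T, ‖u s - z‖ ≤ D) → 0 < σ * ∫ s in (0 : ℝ)..T, inner ℝ (G s (u s)) z) :
    ∃ x u, Continuous u ∧ IsMildSolution U G x u ∧ ∀ t, 0 ≤ t → u (t + T) = u t := by
  have hUx : ∀ x, Continuous fun t => U t x :=
    fun x => hU.comp (continuous_id.prodMk (continuous_const (y := x)))
  obtain ⟨C, ω, hC, -, hUb⟩ := exists_exp_growth_bound hUx hadd
  obtain ⟨hex, k, hdep⟩ := exists_solution_map hU hC hUb hG hGM hL hGL
  choose u huc hu using hex
  let W : H → H := fun x => ∫ s in (0 : ℝ)..T, U (T - s) (G s (u x s))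
  have hGc : ∀ x, Continuous fun s => G s (u x s) := fun x => hG.comp (continuous_id.prodMk (huc x))
  have huT : ∀ x, u x T = U T x + W x := fun x => hu x T hT.le
  have hWc : Continuous W := by
    have h1 : Continuous fun x => u x T := by
      refine (LipschitzWith.of_dist_le_mul (K := Real.toNNReal (2 * C * Real.exp (k * T)))
        fun x y => ?_).continuous
      rw [dist_eq_norm, dist_eq_norm, Real.coe_toNNReal _ (by positivity)]
      exact hdep x y _ _ (huc x) (huc y) (hu x) (hu y) T hT.le
    have h2 : W = fun x => u x T - U T x := by
      ext x; rw [huT, add_sub_cancel_left]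
    rw [h2]
    exact h1.sub (U T).continuous
  obtain ⟨K, hK, hWK'⟩ := exists_isCompact_convolution_mem hU hadd hcomp hT M
  have hWK : ∀ x, W x ∈ K := fun x => hWK' _ (hGc x) fun s => hGM s _
  obtain ⟨A, hA⟩ := exists_rightInverse_one_sub_add_projection (hcomp T hT) hN
    (fun x hx => hadj x hx T hT.le)
  let P := N.starProjection
  let Q : H →L[ℝ] H := (1 - P) ∘L A
  have hPN : ∀ x, P x ∈ N := N.starProjection_apply_mem
  have hPself : ∀ x ∈ N, P x = x := fun x hx => N.starProjection_eq_self_iff.2 hx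
  have hPQ : ∀ x, P (Q x) = 0 := fun x => by
    simp [Q, hPself _ (hPN _)]
  obtain ⟨R₁, hR₁⟩ := (hK.image Q.continuous).isBounded.exists_norm_le
  obtain ⟨C₁, hC₁⟩ := exists_norm_le_on_Icc hUx 0 T
  have hC₁0 : 0 ≤ C₁ := (norm_nonneg _).trans (hC₁ 0 ⟨le_rfl, hT.le⟩)
  have hM : 0 ≤ M := (norm_nonneg _).trans (hGM 0 0)
  obtain ⟨R, hR, hout⟩ := hLL (C₁ * R₁ + C₁ * M * T)
  let Ψ : H → H := fun x => radialRetraction R (P x - σ • P (W x)) + Q (W x)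
  have hΨ : Continuous Ψ := by
    have := continuous_radialRetraction (H := H) hR
    simp only [Ψ]
    fun_prop
  obtain ⟨K₁, hK₁, hK₁s⟩ := (hcomp T hT).image_closedBall_subset_compact
    (f := (U T : H →ₗ[ℝ] H)) R
  have hradN : ∀ x, radialRetraction R (P x - σ • P (W x)) ∈ N := fun x =>
    N.smul_mem _ (N.sub_mem (hPN _) (N.smul_mem _ (hPN _)))
  obtain ⟨x, hx⟩ := exists_fixedPoint_of_range_subset_isCompact hΨ
    (hK₁.add (hK.image Q.continuous)) fun x => by
      refine add_mem_add (hK₁s ⟨radialRetraction R (P x - σ • P (W x)),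
        mem_closedBall_zero_iff.2 (norm_radialRetraction_le hR _), (hN _).1 (hradN x)⟩)
        (mem_image_of_mem _ (hWK x))
  have hPx : radialRetraction R (P x - σ • P (W x)) = P x := by
    conv_rhs => rw [← hx]
    simp only [Ψ, map_add, hPQ, add_zero, hPself _ (hradN x)]
  have hQx : x = P x + Q (W x) := by
    conv_lhs => rw [← hx]
    simp only [Ψ, hPx]
  have hPW : P (W x) = 0 := by
    refine eq_zero_of_radialRetraction_eq hR hσ hPx fun hnorm => ?_
    have hin : inner ℝ (P (W x)) (P x) = ∫ s in (0 : ℝ)..T, inner ℝ (G s (u x s)) (P x) := by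
      rw [N.inner_starProjection_left_eq_right, hPself _ (hPN x), real_inner_comm,
        ← innerSL_apply_apply ℝ, ← ContinuousLinearMap.intervalIntegral_comp_comm _
        ((continuous_convolution_integrand hU (hGc x) T).intervalIntegrable _ _)]
      refine intervalIntegral.integral_congr fun s hs => ?_
      rw [uIcc_of_le hT.le] at hs
      simp only [innerSL_apply_apply]
      rw [real_inner_comm, hadj _ (hPN x) _ (by linarith [hs.2])]
    rw [hin]
    refine hout (u x) (huc x) (P x) (hPN x) hnorm fun s hs => ?_
    have h1 : u x s - P x = U s (Q (W x)) + ∫ r in (0 : ℝ)..s, U (s - r) (G r (u x r)) := by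
      rw [hu x s hs.1]
      nth_rewrite 1 [hQx]
      rw [map_add, hfix _ (hPN x) s hs.1]
      abel
    rw [h1]
    refine (norm_add_le _ _).trans (add_le_add ?_ ?_)
    · exact ((U s).le_opNorm _).trans (mul_le_mul (hC₁ s hs) (hR₁ _ (mem_image_of_mem _ (hWK x)))
        (norm_nonneg _) hC₁0)
    · have := intervalIntegral.norm_integral_le_of_norm_le_const (a := 0) (b := s)
        (f := fun r => U (s - r) (G r (u x r))) (C := C₁ * M) fun r hr => by
          rw [uIoc_of_le hs.1] at hr
          exact ((U (s - r)).le_opNorm _).trans (mul_le_mul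
            (hC₁ _ ⟨by linarith [hr.2], by linarith [hr.1, hs.2]⟩) (hGM _ _) (norm_nonneg _) hC₁0)
      refine this.trans ?_
      rw [sub_zero, abs_of_nonneg hs.1]
      gcongr
      exact hs.2
  have hfp : u x T = x := by
    have hy := hA (W x)
    set y := A (W x)
    have hPU : ∀ v, P (U T v) = P v := fun v => by
      rw [← sub_eq_zero, ← map_sub]
      refine (N.starProjection_apply_eq_zero_iff).2 ?_
      rw [Submodule.mem_orthogonal']
      intro z hz
      rw [inner_sub_left, hadj z hz T hT.le, sub_self]
    have hPy : P y = 0 := by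
      have := congrArg P hy
      rw [hPW, map_add, map_sub, hPU, sub_self, zero_add] at this
      rwa [hPself _ (hPN y)] at this
    have hQy : Q (W x) = y := by
      simp [Q, y, hPy]
    have hy' : y - U T y = W x := by
      rw [← hy]; simp [P] at hPy; simp [hPy]
    rw [huT]
    nth_rewrite 1 [hQx]
    rw [hQy, map_add, hfix _ (hPN x) T hT.le, ← hy', add_assoc, add_sub_cancel]
    rw [← hQy]
    exact hQx.symm
  refine ⟨x, u x, huc x, hu x, fun t ht => ?_⟩
  have htr := (hu x).translate hU hadd hT.le hG hper (huc x)
  rw [hfp] at htr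
  have := hdep x x _ _ ((huc x).comp (continuous_id.add continuous_const)) (huc x) htr (hu x) t ht
  rw [sub_self, norm_zero, mul_zero] at this
  exact sub_eq_zero.1 (norm_le_zero_iff.1 this)

end Resonance

section Nemytskii

variable {α : Type*} [MeasurableSpace α] {μ : Measure α}
  {g : ℝ → α → ℝ → ℝ} {G : ℝ → Lp ℝ 2 μ → Lp ℝ 2 μ}

theorem nemytskii_norm_le [IsFiniteMeasure μ]
    (hG : ∀ t u, ∀ᵐ x ∂μ, G t u x = g t x (u x)) {m : ℝ} (hm : 0 ≤ m)
    (hb : ∀ᵐ x ∂μ, ∀ t y, |g t x y| ≤ m) :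
    ∃ M, ∀ t u, ‖G t u‖ ≤ M := by
  refine ⟨_, fun t u => Lp.norm_le_of_ae_bound hm ?_⟩
  filter_upwards [hG t u, hb] with x hx hbx
  rw [hx]
  exact hbx t (u x)

theorem nemytskii_norm_sub_le (hG : ∀ t u, ∀ᵐ x ∂μ, G t u x = g t x (u x)) {L : ℝ}
    (hl : ∀ᵐ x ∂μ, ∀ t y₁ y₂, |g t x y₁ - g t x y₂| ≤ L * |y₁ - y₂|) (t : ℝ)
    (u v : Lp ℝ 2 μ) : ‖G t u - G t v‖ ≤ L * ‖u - v‖ := by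
  refine Lp.norm_le_mul_norm_of_ae_le_mul ?_
  filter_upwards [hG t u, hG t v, hl, Lp.coeFn_sub (G t u) (G t v), Lp.coeFn_sub u v]
    with x h1 h2 h3 h4 h5
  rw [h4, h5, Pi.sub_apply, Pi.sub_apply, h1, h2]
  exact h3 t _ _

theorem nemytskii_continuous [IsFiniteMeasure μ]
    (hG : ∀ t u, ∀ᵐ x ∂μ, G t u x = g t x (u x)) {m L : ℝ}
    (hL : 0 ≤ L) (hb : ∀ᵐ x ∂μ, ∀ t y, |g t x y| ≤ m)
    (hl : ∀ᵐ x ∂μ, ∀ t y₁ y₂, |g t x y₁ - g t x y₂| ≤ L * |y₁ - y₂|)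
    (hc : ∀ᵐ x ∂μ, ∀ y, Continuous fun t => g t x y) :
    Continuous fun p : ℝ × Lp ℝ 2 μ => G p.1 p.2 := by
  have hmeas : ∀ t (u : Lp ℝ 2 μ), AEStronglyMeasurable (fun x => g t x (u x)) μ := fun t u =>
    (Lp.aestronglyMeasurable (G t u)).congr (hG t u)
  refine continuous_prod_of_continuous_lipschitzWith' _ ⟨L, hL⟩ (fun t =>
    LipschitzWith.of_dist_le_mul fun u v => ?_)
    fun u => ?_
  · rw [dist_eq_norm, dist_eq_norm]
    exact nemytskii_norm_sub_le hG hl t u v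
  · refine continuous_iff_continuousAt.2 fun t => tendsto_iff_norm_sub_tendsto_zero.2 ?_
    have hsq : ∀ s, ‖G s u - G t u‖ ^ 2 = ∫ x, (g s x (u x) - g t x (u x)) ^ 2 ∂μ := fun s => by
      rw [← real_inner_self_eq_norm_sq, L2.inner_def]
      refine integral_congr_ae ?_
      filter_upwards [hG s u, hG t u, Lp.coeFn_sub (G s u) (G t u)] with x h1 h2 h3
      rw [h3, Pi.sub_apply, h1, h2, real_inner_self_eq_norm_sq, Real.norm_eq_abs, sq_abs]
    have hlim : Tendsto (fun s => ∫ x, (g s x (u x) - g t x (u x)) ^ 2 ∂μ) (𝓝 t) (𝓝 0) := by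
      have := MeasureTheory.tendsto_integral_filter_of_dominated_convergence (μ := μ) (l := 𝓝 t)
        (F := fun s x => (g s x (u x) - g t x (u x)) ^ 2) (f := fun _ => 0)
        (fun _ => (m + m) ^ 2)
        (Eventually.of_forall fun s => ((hmeas s u).sub (hmeas t u)).pow 2)
        (Eventually.of_forall fun s => ?_) (integrable_const _) ?_
      · simpa using this
      · filter_upwards [hb] with x hx
        rw [Real.norm_of_nonneg (sq_nonneg _)]
        exact sq_le_sq' (by linarith [abs_le.1 (hx s (u x)), abs_le.1 (hx t (u x))])
          (by linarith [abs_le.1 (hx s (u x)), abs_le.1 (hx t (u x))])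
      · filter_upwards [hc] with x hx
        have h1 : Continuous fun s => (g s x (u x) - g t x (u x)) ^ 2 :=
          ((hx (u x)).sub continuous_const).pow 2
        simpa using h1.tendsto t
    simp only [← hsq] at hlim
    simpa [Real.sqrt_sq] using hlim.sqrt

theorem tendsto_setIntegral_mul_of_tendsto_inv_smul {φ : α → ℝ → ℝ} {p : α → ℝ} {m : ℝ}
    (hb : ∀ᵐ x ∂μ, ∀ y, |φ x y| ≤ m) {l : Filter ℝ}
    (hp : ∀ᵐ x ∂μ, Tendsto (φ x) l (𝓝 (p x))) {w : ℕ → Lp ℝ 2 μ}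
    (hmeas : ∀ n, AEStronglyMeasurable (fun x => φ x (w n x)) μ) {c : ℕ → ℝ}
    (hc : Tendsto c atTop atTop) {ζ : Lp ℝ 2 μ} (hζi : Integrable ζ μ)
    (hw : Tendsto (fun n => (c n)⁻¹ • w n) atTop (𝓝 ζ)) {E : Set α} (hEm : MeasurableSet E)
    (hE : ∀ x ∈ E, ∀ c y : ℕ → ℝ, Tendsto c atTop atTop →
      Tendsto (fun n => (c n)⁻¹ * y n) atTop (𝓝 (ζ x)) → Tendsto y atTop l) :
    Tendsto (fun n => ∫ x in E, φ x (w n x) * ζ x ∂μ) atTop (𝓝 (∫ x in E, p x * ζ x ∂μ)) := by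
  refine tendsto_of_subseq_tendsto fun ns hns => ?_
  obtain ⟨ms, hms, hae⟩ := (tendstoInMeasure_of_tendsto_Lp (hw.comp hns)).exists_seq_tendsto_ae
  refine ⟨ms, tendsto_integral_of_dominated_convergence (fun x => m * |ζ x|)
    (fun n => ((hmeas _).mul (Lp.aestronglyMeasurable ζ)).restrict)
    (hζi.abs.const_mul m).restrict (fun n => ?_) ?_⟩
  · filter_upwards [ae_restrict_of_ae hb] with x hx
    rw [norm_mul]
    exact mul_le_mul_of_nonneg_right (hx _) (norm_nonneg _)
  · have hco : ∀ᵐ x ∂μ, ∀ n, ((c n)⁻¹ • w n : Lp ℝ 2 μ) x = (c n)⁻¹ * w n x :=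
      ae_all_iff.2 fun n => Lp.coeFn_smul _ _
    filter_upwards [ae_restrict_of_ae hp, ae_restrict_of_ae hae, ae_restrict_of_ae hco,
      ae_restrict_mem hEm] with x hpx hx hcx hxE
    refine (hpx.comp (hE x hxE (fun n => c (ns (ms n))) (fun n => w (ns (ms n)) x)
      (hc.comp (hns.comp hms.tendsto_atTop)) ?_)).mul_const _
    simpa [hcx] using hx

theorem tendsto_atTop_of_tendsto_inv_mul {c y : ℕ → ℝ} {z : ℝ} (hz : 0 < z)
    (hc : Tendsto c atTop atTop) (h : Tendsto (fun n => (c n)⁻¹ * y n) atTop (𝓝 z)) :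
    Tendsto y atTop atTop := by
  refine (hc.atTop_mul_pos hz h).congr' ?_
  filter_upwards [hc.eventually_ne_atTop 0] with n hn
  exact mul_inv_cancel_left₀ hn _

theorem tendsto_atBot_of_tendsto_inv_mul {c y : ℕ → ℝ} {z : ℝ} (hz : z < 0)
    (hc : Tendsto c atTop atTop) (h : Tendsto (fun n => (c n)⁻¹ * y n) atTop (𝓝 z)) :
    Tendsto y atTop atBot := by
  refine (hc.atTop_mul_neg hz h).congr' ?_
  filter_upwards [hc.eventually_ne_atTop 0] with n hn
  exact mul_inv_cancel_left₀ hn _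

theorem tendsto_intervalIntegral_inner_indicator [IsFiniteMeasure μ]
    (hG : ∀ t u, ∀ᵐ x ∂μ, G t u x = g t x (u x)) {m : ℝ} (hm : 0 ≤ m)
    (hb : ∀ᵐ x ∂μ, ∀ t y, |g t x y| ≤ m)
    (hGc : Continuous fun p : ℝ × Lp ℝ 2 μ => G p.1 p.2) {l : Filter ℝ} {p : ℝ → α → ℝ}
    {T : ℝ} (hT : 0 ≤ T) (hp : ∀ᵐ x ∂μ, ∀ t, 0 ≤ t → Tendsto (g t x) l (𝓝 (p t x)))
    {w : ℕ → ℝ → Lp ℝ 2 μ} (hwc : ∀ n, Continuous (w n)) {c : ℕ → ℝ}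
    (hc : Tendsto c atTop atTop) {ζ : Lp ℝ 2 μ}
    (hw : ∀ s ∈ Icc 0 T, Tendsto (fun n => (c n)⁻¹ • w n s) atTop (𝓝 ζ)) {E : Set α}
    (hEm : MeasurableSet E)
    (hE : ∀ x ∈ E, ∀ c y : ℕ → ℝ, Tendsto c atTop atTop →
      Tendsto (fun n => (c n)⁻¹ * y n) atTop (𝓝 (ζ x)) → Tendsto y atTop l) :
    Tendsto (fun n => ∫ s in (0 : ℝ)..T,
        inner ℝ (G s (w n s)) (((Lp.memLp ζ).indicator hEm).toLp (E.indicator ζ))) atTop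
      (𝓝 (∫ s in (0 : ℝ)..T, ∫ x in E, p s x * ζ x ∂μ)) := by
  obtain ⟨M, hM⟩ := nemytskii_norm_le hG hm hb
  have hζi : Integrable ζ μ := (Lp.memLp ζ).integrable one_le_two
  set e := ((Lp.memLp ζ).indicator hEm).toLp (E.indicator ζ)
  have heq : ∀ s (v : Lp ℝ 2 μ), inner ℝ (G s v) e = ∫ x in E, g s x (v x) * ζ x ∂μ := by
    intro s v
    rw [L2.inner_def, ← MeasureTheory.integral_indicator hEm]
    refine integral_congr_ae ?_
    filter_upwards [hG s v, ((Lp.memLp ζ).indicator hEm).coeFn_toLp] with x h1 h2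
    rw [h1, h2]
    by_cases hx : x ∈ E <;> simp [hx, mul_comm]
  refine intervalIntegral.tendsto_integral_filter_of_dominated_convergence (fun _ => M * ‖e‖)
    (Eventually.of_forall fun n => ?_) (Eventually.of_forall fun n => ?_)
    intervalIntegrable_const ?_
  · exact ((hGc.comp (continuous_id.prodMk (hwc n))).inner continuous_const).aestronglyMeasurable
  · exact ae_of_all _ fun s _ => (norm_inner_le_norm _ _).trans
      (mul_le_mul_of_nonneg_right (hM _ _) (norm_nonneg _))
  · refine ae_of_all _ fun s hs => ?_
    rw [uIoc_of_le hT] at hs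
    simp only [heq]
    refine tendsto_setIntegral_mul_of_tendsto_inv_smul (hb.mono fun x hx => hx s)
      (hp.mono fun x hx => hx s hs.1.le)
      (fun n => (Lp.aestronglyMeasurable (G s (w n s))).congr (hG _ _)) hc hζi
      (hw s ⟨hs.1.le, hs.2⟩) hEm hE

theorem tendsto_intervalIntegral_inner_nemytskii [IsFiniteMeasure μ]
    (hG : ∀ t u, ∀ᵐ x ∂μ, G t u x = g t x (u x)) {m : ℝ} (hm : 0 ≤ m)
    (hb : ∀ᵐ x ∂μ, ∀ t y, |g t x y| ≤ m)
    (hGc : Continuous fun p : ℝ × Lp ℝ 2 μ => G p.1 p.2) {fp fm : ℝ → α → ℝ}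
    {T : ℝ} (hT : 0 ≤ T) (hfp : ∀ᵐ x ∂μ, ∀ t, 0 ≤ t → Tendsto (g t x) atTop (𝓝 (fp t x)))
    (hfm : ∀ᵐ x ∂μ, ∀ t, 0 ≤ t → Tendsto (g t x) atBot (𝓝 (fm t x)))
    {w : ℕ → ℝ → Lp ℝ 2 μ} (hwc : ∀ n, Continuous (w n)) {c : ℕ → ℝ}
    (hc : Tendsto c atTop atTop) {ζ : Lp ℝ 2 μ}
    (hw : ∀ s ∈ Icc 0 T, Tendsto (fun n => (c n)⁻¹ • w n s) atTop (𝓝 ζ)) :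
    Tendsto (fun n => ∫ s in (0 : ℝ)..T, inner ℝ (G s (w n s)) ζ) atTop
      (𝓝 ((∫ s in (0 : ℝ)..T, ∫ x in {x | 0 < ζ x}, fp s x * ζ x ∂μ) +
        ∫ s in (0 : ℝ)..T, ∫ x in {x | ζ x < 0}, fm s x * ζ x ∂μ)) := by
  have hζm : Measurable ζ := (Lp.stronglyMeasurable ζ).measurable
  have hpos : MeasurableSet {x | 0 < ζ x} := measurableSet_lt measurable_const hζm
  have hneg : MeasurableSet {x | ζ x < 0} := measurableSet_lt hζm measurable_const
  refine ((tendsto_intervalIntegral_inner_indicator hG hm hb hGc hT hfp hwc hc hw hpos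
    fun x hx c y => tendsto_atTop_of_tendsto_inv_mul hx).add
    (tendsto_intervalIntegral_inner_indicator hG hm hb hGc hT hfm hwc hc hw hneg
    fun x hx c y => tendsto_atBot_of_tendsto_inv_mul hx)).congr fun n => ?_
  have hcont : ∀ e : Lp ℝ 2 μ, IntervalIntegrable (fun s => inner ℝ (G s (w n s)) e) volume 0 T :=
    fun e => ((hGc.comp (continuous_id.prodMk (hwc n))).inner
      continuous_const).intervalIntegrable _ _
  rw [← intervalIntegral.integral_add (hcont _) (hcont _)]
  simp only [← inner_add_right]
  congr! 4
  refine Lp.ext ?_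
  filter_upwards [((Lp.memLp ζ).indicator hpos).coeFn_toLp,
    ((Lp.memLp ζ).indicator hneg).coeFn_toLp, Lp.coeFn_add
      (((Lp.memLp ζ).indicator hpos).toLp _) (((Lp.memLp ζ).indicator hneg).toLp _)]
    with x h1 h2 h3
  rw [h3, Pi.add_apply, h1, h2]
  rcases lt_trichotomy (ζ x) 0 with h | h | h
  · simp [h, h.not_gt]
  · simp [h]
  · simp [h, h.not_gt]

/-- A strict Landesman-Lazer condition on the unit sphere of a subspace with compact unit ball
gives the sign condition on large spheres, uniformly in bounded perturbations. -/
theorem exists_radius_forall_pos_intervalIntegral_inner [IsFiniteMeasure μ]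
    (hG : ∀ t u, ∀ᵐ x ∂μ, G t u x = g t x (u x)) {m : ℝ} (hm : 0 ≤ m)
    (hb : ∀ᵐ x ∂μ, ∀ t y, |g t x y| ≤ m)
    (hGc : Continuous fun p : ℝ × Lp ℝ 2 μ => G p.1 p.2) {fp fm : ℝ → α → ℝ}
    {T : ℝ} (hT : 0 ≤ T) (hfp : ∀ᵐ x ∂μ, ∀ t, 0 ≤ t → Tendsto (g t x) atTop (𝓝 (fp t x)))
    (hfm : ∀ᵐ x ∂μ, ∀ t, 0 ≤ t → Tendsto (g t x) atBot (𝓝 (fm t x)))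
    (N : Submodule ℝ (Lp ℝ 2 μ)) (hN : IsCompact ((N : Set (Lp ℝ 2 μ)) ∩ Metric.sphere 0 1))
    {σ : ℝ}
    (hLL : ∀ ζ ∈ N, ‖ζ‖ = 1 →
      0 < σ * ((∫ s in (0 : ℝ)..T, ∫ x in {x | 0 < ζ x}, fp s x * ζ x ∂μ) +
        ∫ s in (0 : ℝ)..T, ∫ x in {x | ζ x < 0}, fm s x * ζ x ∂μ)) (D : ℝ) :
    ∃ R > 0, ∀ u : ℝ → Lp ℝ 2 μ, Continuous u → ∀ z ∈ N, ‖z‖ = R →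
      (∀ s ∈ Icc 0 T, ‖u s - z‖ ≤ D) →
      0 < σ * ∫ s in (0 : ℝ)..T, inner ℝ (G s (u s)) z := by
  by_contra! hcon
  obtain ⟨M, hM⟩ := nemytskii_norm_le hG hm hb
  have hpos : ∀ n : ℕ, (0 : ℝ) < n + 1 := fun n => by positivity
  choose u huc z hzN hzn huz hle using fun n : ℕ => hcon (n + 1) (hpos n)
  obtain ⟨ζ, ⟨hζN, hζ⟩, φ, hφ, hlim⟩ := hN.tendsto_subseq
    (x := fun n => ((n : ℝ) + 1)⁻¹ • z n) fun n => ⟨N.smul_mem _ (hzN n), by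
      rw [mem_sphere_zero_iff_norm, norm_smul, hzn, norm_inv, Real.norm_of_nonneg (hpos n).le,
        inv_mul_cancel₀ (hpos n).ne']⟩
  have hc : Tendsto (fun n => (φ n : ℝ) + 1) atTop atTop :=
    tendsto_atTop_add_const_right _ _ (tendsto_natCast_atTop_atTop.comp hφ.tendsto_atTop)
  have hw : ∀ s ∈ Icc 0 T, Tendsto (fun n => ((φ n : ℝ) + 1)⁻¹ • u (φ n) s) atTop (𝓝 ζ) := by
    intro s hs
    have h1 : Tendsto (fun n => ((φ n : ℝ) + 1)⁻¹ • (u (φ n) s - z (φ n))) atTop (𝓝 0) := by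
      refine squeeze_zero_norm (fun n => ?_) (by simpa using hc.inv_tendsto_atTop.mul_const D)
      rw [norm_smul, norm_inv, Real.norm_of_nonneg (hpos _).le]
      exact mul_le_mul_of_nonneg_left (huz _ s hs) (inv_nonneg.2 (hpos _).le)
    refine (add_zero ζ ▸ hlim.add h1).congr fun n => ?_
    rw [Function.comp_apply, ← smul_add, add_sub_cancel]
  have hmain := tendsto_intervalIntegral_inner_nemytskii hG hm hb hGc hT hfp hfm
    (fun n => huc (φ n)) hc hw
  have hGu : ∀ n, Continuous fun s => G s (u n s) := fun n =>
    hGc.comp (continuous_id.prodMk (huc n))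
  have hint : ∀ n (e : Lp ℝ 2 μ),
      IntervalIntegrable (fun s => inner ℝ (G s (u n s)) e) volume 0 T :=
    fun n e => ((hGu n).inner continuous_const).intervalIntegrable _ _
  have hdiff : Tendsto (fun n => ∫ s in (0 : ℝ)..T,
      inner ℝ (G s (u (φ n) s)) (((φ n : ℝ) + 1)⁻¹ • z (φ n) - ζ)) atTop (𝓝 0) := by
    refine squeeze_zero_norm (fun n => intervalIntegral.norm_integral_le_of_norm_le_const
      fun s _ => (norm_inner_le_norm _ _).trans
        (mul_le_mul_of_nonneg_right (hM _ _) (norm_nonneg _))) ?_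
    have := ((tendsto_iff_norm_sub_tendsto_zero.1 hlim).const_mul M).mul_const |T - 0|
    simpa using this
  have hsum := (hmain.add hdiff).const_mul σ
  rw [add_zero] at hsum
  refine (hLL ζ hζN (mem_sphere_zero_iff_norm.1 hζ)).not_ge
    (le_of_tendsto hsum (Eventually.of_forall fun n => ?_))
  rw [← intervalIntegral.integral_add (hint _ _) (hint _ _)]
  simp only [← inner_add_right, add_sub_cancel, inner_smul_right,
    intervalIntegral.integral_const_mul]
  rw [mul_left_comm]
  exact mul_nonpos_of_nonneg_of_nonpos (inv_nonneg.2 (hpos _).le) (hle _)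

end Nemytskii

/-- existence of a `T`-periodic mild solution of
`u' = -Au + λu + F(t,u)` in `X = L²(Ω)` under either of the Landesman–Lazer
type conditions (LL+) or (LL−). -/
theorem statement16
    (n : ℕ) (Ω : Set (EuclideanSpace ℝ (Fin n)))
    (hΩo : IsOpen Ω) (hΩb : Bornology.IsBounded Ω)
    (T : ℝ) (hT : 0 < T)
    (S : ℝ → Lp ℝ 2 (volume.restrict Ω) →L[ℝ] Lp ℝ 2 (volume.restrict Ω))
    (hS0 : S 0 = 1)
    (hSadd : ∀ t s : ℝ, 0 ≤ t → 0 ≤ s → S (t + s) = (S t).comp (S s))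
    (hScont : ∀ x : Lp ℝ 2 (volume.restrict Ω),
      ContinuousOn (fun t => S t x) (Set.Ici (0:ℝ)))
    (hScomp : ∀ t : ℝ, 0 < t → ∀ B : Set (Lp ℝ 2 (volume.restrict Ω)),
      Bornology.IsBounded B → IsCompact (closure (S t '' B)))
    (lam : ℝ)
    -- `N_λ = {x : e^{λT} S(T) x = x}` is a nonzero subspace, pointwise fixed (with
    -- its elements) by `e^{λt}S(t)` and by `e^{λt}S(t)*` for all `t ≥ 0`
    (hNne : ∃ x : Lp ℝ 2 (volume.restrict Ω),
      Real.exp (lam * T) • S T x = x ∧ x ≠ 0)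
    (hfix : ∀ x : Lp ℝ 2 (volume.restrict Ω), Real.exp (lam * T) • S T x = x →
      ∀ t : ℝ, 0 ≤ t → Real.exp (lam * t) • S t x = x)
    (hfixadj : ∀ x : Lp ℝ 2 (volume.restrict Ω), Real.exp (lam * T) • S T x = x →
      ∀ t : ℝ, 0 ≤ t → Real.exp (lam * t) • (ContinuousLinearMap.adjoint (S t)) x = x)
    (f : ℝ → EuclideanSpace ℝ (Fin n) → ℝ → ℝ)
    (hfc : ContinuousOn (fun p : ℝ × EuclideanSpace ℝ (Fin n) × ℝ =>
      f p.1 p.2.1 p.2.2) (Set.Ici (0:ℝ) ×ˢ Ω ×ˢ Set.univ))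
    -- condition (a): boundedness
    (m : ℝ) (hm : 0 < m)
    (hfa : ∀ t : ℝ, 0 ≤ t → ∀ x ∈ Ω, ∀ y : ℝ, |f t x y| ≤ m)
    -- condition (b): uniform Lipschitz continuity
    (L : ℝ) (hL : 0 < L)
    (hfb : ∀ t : ℝ, 0 ≤ t → ∀ x ∈ Ω, ∀ y₁ y₂ : ℝ,
      |f t x y₁ - f t x y₂| ≤ L * |y₁ - y₂|)
    -- condition (c): `T`-periodicity in time
    (hfT : ∀ t : ℝ, 0 ≤ t → ∀ (x : EuclideanSpace ℝ (Fin n)) (y : ℝ),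
      f (t + T) x y = f t x y)
    -- condition (d): limits at ±∞
    (fp fm : ℝ → EuclideanSpace ℝ (Fin n) → ℝ)
    (hfpc : ContinuousOn (fun p : ℝ × EuclideanSpace ℝ (Fin n) => fp p.1 p.2)
      (Set.Ici (0:ℝ) ×ˢ Ω))
    (hfmc : ContinuousOn (fun p : ℝ × EuclideanSpace ℝ (Fin n) => fm p.1 p.2)
      (Set.Ici (0:ℝ) ×ˢ Ω))
    (hfp : ∀ t : ℝ, 0 ≤ t → ∀ x ∈ Ω,
      Filter.Tendsto (fun y => f t x y) Filter.atTop (nhds (fp t x)))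
    (hfm : ∀ t : ℝ, 0 ≤ t → ∀ x ∈ Ω,
      Filter.Tendsto (fun y => f t x y) Filter.atBot (nhds (fm t x)))
    -- `F` is the Nemytskii operator associated with `f`
    (F : ℝ → Lp ℝ 2 (volume.restrict Ω) → Lp ℝ 2 (volume.restrict Ω))
    (hF : ∀ t : ℝ, 0 ≤ t → ∀ u : Lp ℝ 2 (volume.restrict Ω),
      ∀ᵐ x ∂(volume.restrict Ω), F t u x = f t x (u x))
    -- the Landesman–Lazer type condition (LL+) or (LL−)
    (hLL :
      (∀ u : Lp ℝ 2 (volume.restrict Ω),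
        Real.exp (lam * T) • S T u = u → ‖u‖ = 1 →
        0 < (∫ t in (0:ℝ)..T, ∫ x in {x | 0 < u x}, fp t x * u x ∂(volume.restrict Ω)) +
          (∫ t in (0:ℝ)..T, ∫ x in {x | u x < 0}, fm t x * u x ∂(volume.restrict Ω))) ∨
      (∀ u : Lp ℝ 2 (volume.restrict Ω),
        Real.exp (lam * T) • S T u = u → ‖u‖ = 1 →
        (∫ t in (0:ℝ)..T, ∫ x in {x | 0 < u x}, fp t x * u x ∂(volume.restrict Ω)) +
          (∫ t in (0:ℝ)..T, ∫ x in {x | u x < 0}, fm t x * u x ∂(volume.restrict Ω)) < 0)) :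
    ∃ u : ℝ → Lp ℝ 2 (volume.restrict Ω),
      ContinuousOn u (Set.Ici (0:ℝ)) ∧
      (∀ t : ℝ, 0 ≤ t → u (t + T) = u t) ∧
      ∀ t : ℝ, 0 ≤ t →
        u t = Real.exp (lam * t) • S t (u 0) +
          ∫ s in (0:ℝ)..t, Real.exp (lam * (t - s)) • S (t - s) (F s (u s)) := by
  have : IsFiniteMeasure (volume.restrict Ω) := isFiniteMeasure_restrict.2 hΩb.measure_lt_top.ne
  have hmem : ∀ᵐ x ∂(volume.restrict Ω), x ∈ Ω := ae_restrict_mem hΩo.measurableSet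
  let U : ℝ → Lp ℝ 2 (volume.restrict Ω) →L[ℝ] Lp ℝ 2 (volume.restrict Ω) :=
    fun t => Real.exp (lam * max t 0) • S (max t 0)
  have hUt : ∀ t, 0 ≤ t → ∀ x, U t x = Real.exp (lam * t) • S t x := fun t ht x => by
    simp [U, max_eq_left ht]
  have hUx : ∀ x, Continuous fun t => U t x := fun x =>
    (by fun_prop : Continuous fun t : ℝ => Real.exp (lam * max t 0)).smul
      ((hScont x).comp_continuous (by fun_prop) fun t => le_max_right t 0)
  have hadd : ∀ t s, 0 ≤ t → 0 ≤ s → U (t + s) = (U t).comp (U s) := fun t s ht hs => by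
    ext1 x
    rw [ContinuousLinearMap.comp_apply, hUt _ (add_nonneg ht hs), hUt _ ht, hUt _ hs, map_smul,
      smul_smul, hSadd t s ht hs, mul_add, Real.exp_add, ContinuousLinearMap.comp_apply]
  have hcomp : ∀ t, 0 < t → IsCompactOperator (U t) := fun t ht => by
    have h1 : IsCompactOperator (S t) :=
      (isCompactOperator_iff_exists_mem_nhds_isCompact_closure_image _).2
        ⟨Metric.ball 0 1, Metric.ball_mem_nhds _ one_pos, hScomp t ht _ Metric.isBounded_ball⟩
    have h2 : (U t : Lp ℝ 2 (volume.restrict Ω) → _) = Real.exp (lam * t) • S t :=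
      funext (hUt t ht.le)
    rw [h2]
    exact h1.smul _
  let N : Submodule ℝ (Lp ℝ 2 (volume.restrict Ω)) := LinearMap.ker (U T - 1).toLinearMap
  have hN : ∀ x, x ∈ N ↔ U T x = x := fun x => by simp [N, sub_eq_zero]
  have hNS : ∀ x ∈ N, Real.exp (lam * T) • S T x = x := fun x hx => by
    rw [← hUt T hT.le, (hN x).1 hx]
  have hNcl : IsClosed (N : Set (Lp ℝ 2 (volume.restrict Ω))) := (U T - 1).isClosed_ker
  have : CompleteSpace N := hNcl.completeSpace_coe
  have hNc : IsCompact ((N : Set (Lp ℝ 2 (volume.restrict Ω))) ∩ Metric.sphere 0 1) := by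
    obtain ⟨K, hK, hKs⟩ := (hcomp T hT).image_closedBall_subset_compact
      (f := (U T).toLinearMap) 1
    exact hK.of_isClosed_subset (hNcl.inter Metric.isClosed_sphere) fun x hx =>
      hKs ⟨x, Metric.sphere_subset_closedBall hx.2, (hN x).1 hx.1⟩
  have hadj : ∀ x ∈ N, ∀ t, 0 ≤ t → ∀ y, inner ℝ (U t y) x = inner ℝ y x := fun x hx t ht y => by
    rw [hUt t ht, real_inner_smul_left, ← ContinuousLinearMap.adjoint_inner_right,
      ← real_inner_smul_right, hfixadj x (hNS x hx) t ht]
  have hfix' : ∀ x ∈ N, ∀ t, 0 ≤ t → U t x = x := fun x hx t ht => by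
    rw [hUt t ht, hfix x (hNS x hx) t ht]
  let g : ℝ → EuclideanSpace ℝ (Fin n) → ℝ → ℝ := fun t => f (max t 0)
  let G : ℝ → Lp ℝ 2 (volume.restrict Ω) → Lp ℝ 2 (volume.restrict Ω) := fun t => F (max t 0)
  have hG : ∀ t u, ∀ᵐ x ∂(volume.restrict Ω), G t u x = g t x (u x) :=
    fun t u => hF _ (le_max_right t 0) u
  have hb : ∀ᵐ x ∂(volume.restrict Ω), ∀ t y, |g t x y| ≤ m := by
    filter_upwards [hmem] with x hx t y using hfa _ (le_max_right t 0) x hx y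
  have hl : ∀ᵐ x ∂(volume.restrict Ω), ∀ t y₁ y₂, |g t x y₁ - g t x y₂| ≤ L * |y₁ - y₂| := by
    filter_upwards [hmem] with x hx t y₁ y₂ using hfb _ (le_max_right t 0) x hx y₁ y₂
  have hgc : ∀ᵐ x ∂(volume.restrict Ω), ∀ y, Continuous fun t => g t x y := by
    filter_upwards [hmem] with x hx y
    exact hfc.comp_continuous (f := fun t : ℝ => (max t 0, x, y)) (by fun_prop)
      fun t => ⟨le_max_right t 0, hx, mem_univ _⟩
  have hgp : ∀ᵐ x ∂(volume.restrict Ω), ∀ t, 0 ≤ t →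
      Tendsto (g t x) atTop (𝓝 (fp t x)) := by
    filter_upwards [hmem] with x hx t ht
    simpa [g, max_eq_left ht] using hfp t ht x hx
  have hgm : ∀ᵐ x ∂(volume.restrict Ω), ∀ t, 0 ≤ t →
      Tendsto (g t x) atBot (𝓝 (fm t x)) := by
    filter_upwards [hmem] with x hx t ht
    simpa [g, max_eq_left ht] using hfm t ht x hx
  have hper : ∀ s, 0 ≤ s → ∀ v, G (s + T) v = G s v := fun s hs v => by
    refine Lp.ext ?_
    filter_upwards [hG (s + T) v, hG s v] with x h1 h2
    rw [h1, h2]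
    simp only [g, max_eq_left hs, max_eq_left (add_nonneg hs hT.le)]
    exact hfT s hs x _
  have hGc := nemytskii_continuous hG hL.le hb hl hgc
  obtain ⟨M, hM⟩ := nemytskii_norm_le hG hm.le hb
  obtain ⟨σ, hσ, hLLσ⟩ : ∃ σ : ℝ, σ ≠ 0 ∧ ∀ ζ ∈ N, ‖ζ‖ = 1 → 0 < σ *
      ((∫ t in (0:ℝ)..T, ∫ x in {x | 0 < ζ x}, fp t x * ζ x ∂(volume.restrict Ω)) +
        ∫ t in (0:ℝ)..T, ∫ x in {x | ζ x < 0}, fm t x * ζ x ∂(volume.restrict Ω)) := by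
    rcases hLL with h | h
    · exact ⟨1, one_ne_zero, fun ζ hζ h1 => by rw [one_mul]; exact h ζ (hNS ζ hζ) h1⟩
    · exact ⟨-1, by norm_num, fun ζ hζ h1 => by
        rw [neg_one_mul, neg_pos]; exact h ζ (hNS ζ hζ) h1⟩
  obtain ⟨x, u, huc, hu, huT⟩ := exists_periodic_isMildSolution
    (continuous_uncurry_of_strongly_continuous hUx) hadd hcomp hT N hN hfix' hadj hGc hM hL.le
    (nemytskii_norm_sub_le hG hl) hper hσ
    (exists_radius_forall_pos_intervalIntegral_inner hG hm.le hb hGc hT.le hgp hgm N hNc hLLσ)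
  refine ⟨u, huc.continuousOn, huT, fun t ht => ?_⟩
  have hu0 : u 0 = x := by
    have := hu 0 le_rfl
    simpa [hUt 0 le_rfl, hS0] using this
  rw [hu t ht, hUt t ht, hu0]
  congr 1
  refine intervalIntegral.integral_congr fun s hs => ?_
  rw [uIcc_of_le ht] at hs
  simp only [hUt (t - s) (by linarith [hs.2]), G, max_eq_left hs.1]
end
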